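/- With the same data as for a birationally parameterized plane curve C of degree d with Hilbert–Burch matrix φ of column degrees d₁ ≤ d₂ over an algebraically closed field: every infinitely near singularity of C has multiplicity at most d₁. -/

import Mathlib

set_option maxHeartbeats 1000000
set_option synthInstance.maxHeartbeats 1000000

open MvPolynomial

/-- The height of an ideal: the infimum of the heights of the primes containing it. -/
noncomputable def idealHeight {R : Type*} [CommRing R] (I : Ideal R) : ℕ∞ :=
  ⨅ (P : PrimeSpectrum R) (_ : I ≤ P.asIdeal), Order.height P

/-- `e` is the Hilbert–Samuel multiplicity of the ideal `J` on the (one-dimensional) ring `R`,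
characterized as the limit of `λ(R/Jⁿ)/n`; lengths are expressed as Krull dimensions of
submodule lattices. -/
def IsHSMultOfDimOne (R : Type*) [CommRing R] (J : Ideal R) (e : ℕ) : Prop :=
  ∃ len : ℕ → ℕ,
    (∀ n : ℕ, Order.krullDim (Submodule R (R ⧸ J ^ n)) = ((len n : ℕ∞) : WithBot ℕ∞)) ∧
    Filter.Tendsto (fun n : ℕ => (len n : ℝ) / (n : ℝ)) Filter.atTop (nhds (e : ℝ))

/-- The ideal of nonunits of a subring (the maximal ideal, when the subring is local). -/
def nuIdeal {K : Type*} [CommRing K] (O : Subring K) : Ideal O :=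
  Ideal.span {x : O | ¬IsUnit x}

/-- The set `m/f = {x ∈ K : f·x ∈ m}` used to form the blow-up ring `O[m/f]`. -/
def blowSet {K : Type*} [CommRing K] (O : Subring K) (f : O) : Set K :=
  {x : K | ∃ m : O, m ∈ nuIdeal O ∧ (f : K) * x = (m : K)}

/-- The blow-up ring `O[m/f]`. -/
def blowRing {K : Type*} [CommRing K] (O : Subring K) (f : O) : Subring K :=
  Subring.closure ((O : Set K) ∪ blowSet O f)

/-- The localization of `O'` at `N`, as a subset of the ambient total quotient ring. -/
def locSet {K : Type*} [CommRing K] (O' : Subring K) (N : Ideal O') : Set K :=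
  {x : K | ∃ a s : O', s ∉ N ∧ (s : K) * x = (a : K)}

/-- `O'` is one of the (local rings of the) points in the first neighborhood of the point with
local ring `O`: it is a localization, at a maximal ideal, of `O[m/f]` where `f ∈ m` satisfies
`m^{r+1} = f·m^r` for some `r ≥ 0`. -/
def IsFirstNbhdOf {K : Type*} [CommRing K] (O O' : Subring K) : Prop :=
  ∃ f : O, ¬IsUnit f ∧
    (∃ r : ℕ, nuIdeal O ^ (r + 1) = Ideal.span {f} * nuIdeal O ^ r) ∧
    ∃ N : Ideal (blowRing O f), N.IsMaximal ∧
      O' = Subring.closure (locSet (blowRing O f) N)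

/-- `O'` is (the local ring of) a point infinitely near to the point with local ring `O`:
it is obtained from `O` by finitely many (at least one) blow-up steps. -/
def IsInfinitelyNearTo {K : Type*} [CommRing K] (O O' : Subring K) : Prop :=
  Relation.TransGen IsFirstNbhdOf O O'

/-- The homogeneous coordinate ring `k[g₁,g₂,g₃]` of the parameterized plane curve. -/
noncomputable def coneRing {k : Type*} [Field k] (g : Fin 3 → MvPolynomial (Fin 2) k) :
    Subalgebra k (MvPolynomial (Fin 2) k) :=
  Algebra.adjoin k (Set.range g)

/-- The generators `g i`, as elements of `k[g₁,g₂,g₃]`. -/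
noncomputable def coneGen {k : Type*} [Field k] (g : Fin 3 → MvPolynomial (Fin 2) k)
    (i : Fin 3) : coneRing g :=
  ⟨g i, Algebra.subset_adjoin ⟨i, rfl⟩⟩

/-- The homogeneous prime of `k[g₁,g₂,g₃]` corresponding to the point `p = [a₁:a₂:a₃]` of the
curve. -/
noncomputable def pointIdeal {k : Type*} [Field k] (g : Fin 3 → MvPolynomial (Fin 2) k)
    (a : Fin 3 → k) : Ideal (coneRing g) :=
  Ideal.span {x : coneRing g | ∃ i j : Fin 3, x = a i • coneGen g j - a j • coneGen g i}

/-- The local ring `O_{C,p}` of the curve `C` at the point `p = [a₁:a₂:a₃]`, realized as the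
subring of the total quotient ring of `k[g₁,g₂,g₃]` consisting of fractions `f/s` with `f`, `s`
homogeneous of the same degree and `s ∉ 𝔭`. -/
noncomputable def curveLocalRing {k : Type*} [Field k] (g : Fin 3 → MvPolynomial (Fin 2) k)
    (a : Fin 3 → k) : Subring (FractionRing (coneRing g)) :=
  Subring.closure
    {x : FractionRing (coneRing g) |
      ∃ f s : coneRing g, ∃ e : ℕ,
        ((f : MvPolynomial (Fin 2) k).IsHomogeneous e) ∧
        ((s : MvPolynomial (Fin 2) k).IsHomogeneous e) ∧
        s ∉ pointIdeal g a ∧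
        algebraMap (coneRing g) (FractionRing (coneRing g)) s * x =
          algebraMap (coneRing g) (FractionRing (coneRing g)) f}

/-- `[a₁:a₂:a₃]` lies on the curve parameterized by `g₁, g₂, g₃`. -/
def onCurve {k : Type*} [Field k] (g : Fin 3 → MvPolynomial (Fin 2) k) (a : Fin 3 → k) : Prop :=
  ∃ q : Fin 2 → k, q ≠ 0 ∧ ∃ t : k, t ≠ 0 ∧ ∀ i, a i = t * eval q (g i)


section AbstractPart

open Polynomial IntermediateField

lemma aux_aeval_mem {k K : Type*} [Field k] [Field K] [Algebra k K] {t : K} (S : Subalgebra k K)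
    (p : k[X]) (htS : t ∈ S) : Polynomial.aeval t p ∈ S := by
  rw [Polynomial.aeval_eq_sum_range]
  exact S.sum_mem fun i _ => S.smul_mem (S.pow_mem htS i) _

/-- Division with remainder in a ring between `k[t]` and `k(t)`. -/
lemma aux_division {k K : Type*} [Field k] [Field K] [Algebra k K] (t : K) (S : Subalgebra k K)
    (htS : t ∈ S) (hSE : ∀ x ∈ S, x ∈ k⟮t⟯) (x : K) (F : k[X]) (hF : F ≠ 0)
    (hFx : ∃ s ∈ S, Polynomial.aeval t F = x * s) (y : K) (hy : y ∈ S) :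
    ∃ r : k[X], r.degree < F.degree ∧ ∃ s ∈ S, y = Polynomial.aeval t r + x * s := by
  classical
  have hpol : ∀ p : k[X], Polynomial.aeval t p ∈ S := fun p => aux_aeval_mem _ p htS
  let I : Ideal k[X] :=
    { carrier := {G | ∃ s ∈ S, Polynomial.aeval t G = x * s}
      add_mem' := by
        rintro a b ⟨s, hs, h1⟩ ⟨s', hs', h2⟩
        exact ⟨s + s', S.add_mem hs hs', by rw [map_add, h1, h2]; ring⟩
      zero_mem' := ⟨0, S.zero_mem, by simp⟩
      smul_mem' := by
        rintro c a ⟨s, hs, h1⟩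
        exact ⟨Polynomial.aeval t c * s, S.mul_mem (hpol c) hs, by
          rw [smul_eq_mul, map_mul, h1]; ring⟩ }
  have hI : ∀ G, G ∈ I ↔ ∃ s ∈ S, Polynomial.aeval t G = x * s := fun G => Iff.rfl
  obtain ⟨G, hG⟩ := (IsPrincipalIdealRing.principal I).principal
  have hG' : ∀ H, H ∈ I ↔ G ∣ H := by
    intro H
    rw [hG]
    exact Ideal.mem_span_singleton
  have hGF : G ∣ F := (hG' F).1 hFx
  have hG0 : G ≠ 0 := by
    rintro rfl
    exact hF (zero_dvd_iff.1 hGF)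
  have hdeg : G.degree ≤ F.degree := Polynomial.degree_le_of_dvd hGF hF
  obtain ⟨sG, hsG, hGx⟩ := (hI G).1 ((hG' G).2 dvd_rfl)
  obtain ⟨a, b, hab⟩ := (mem_adjoin_simple_iff k y).1 (hSE y hy)
  by_cases hb : Polynomial.aeval t b = 0
  · rw [hb, div_zero] at hab
    exact ⟨0, by rw [Polynomial.degree_zero]; exact bot_lt_iff_ne_bot.2 (by simpa using hF),
      0, S.zero_mem, by simp [hab]⟩
  have hb0 : b ≠ 0 := by rintro rfl; simp at hb
  -- make coprime
  obtain ⟨a', ha'⟩ := EuclideanDomain.gcd_dvd_left a b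
  obtain ⟨b', hb'⟩ := EuclideanDomain.gcd_dvd_right a b
  have hD0 : EuclideanDomain.gcd a b ≠ 0 := by
    intro h; rw [h, zero_mul] at hb'; exact hb0 hb'
  have hbez := EuclideanDomain.gcd_eq_gcd_ab a b
  set D := EuclideanDomain.gcd a b with hD
  set u := EuclideanDomain.gcdA a b
  set v := EuclideanDomain.gcdB a b
  have hcop : a' * u + b' * v = 1 := by
    apply mul_left_cancel₀ hD0
    calc D * (a' * u + b' * v) = (D * a') * u + (D * b') * v := by ring
      _ = D * 1 := by rw [← ha', ← hb', mul_one]; exact hbez.symm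
  have hbD : Polynomial.aeval t b = Polynomial.aeval t D * Polynomial.aeval t b' := by
    rw [← map_mul, ← hb']
  have haD : Polynomial.aeval t a = Polynomial.aeval t D * Polynomial.aeval t a' := by
    rw [← map_mul, ← ha']
  have hDt : Polynomial.aeval t D ≠ 0 := by
    intro h; rw [h, zero_mul] at hbD; exact hb hbD
  have hbt : Polynomial.aeval t b' ≠ 0 := by
    intro h; rw [h, mul_zero] at hbD; exact hb hbD
  have hy' : Polynomial.aeval t b' * y = Polynomial.aeval t a' := by
    rw [hab, haD, hbD]; field_simp
  have hcopt := congrArg (Polynomial.aeval t) hcop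
  simp only [map_add, map_mul, map_one] at hcopt
  -- 1 / b' ∈ S
  have hinv : ∃ w ∈ S, Polynomial.aeval t b' * w = 1 := by
    refine ⟨y * Polynomial.aeval t u + Polynomial.aeval t v,
      S.add_mem (S.mul_mem hy (hpol u)) (hpol v), ?_⟩
    linear_combination hcopt + hy' * Polynomial.aeval t u
  obtain ⟨w, hw, hw1⟩ := hinv
  have hcop2 : IsCoprime b' G := by
    rw [← EuclideanDomain.gcd_isUnit_iff]
    obtain ⟨b2, hb2⟩ := EuclideanDomain.gcd_dvd_left b' G
    obtain ⟨G2, hG2⟩ := EuclideanDomain.gcd_dvd_right b' G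
    set D2 := EuclideanDomain.gcd b' G
    have h1 : G2 ∈ I := by
      refine ⟨Polynomial.aeval t b2 * w * sG, S.mul_mem (S.mul_mem (hpol _) hw) hsG, ?_⟩
      have e1 : Polynomial.aeval t b' = Polynomial.aeval t D2 * Polynomial.aeval t b2 := by
        rw [← map_mul, ← hb2]
      have e2 : Polynomial.aeval t G = Polynomial.aeval t D2 * Polynomial.aeval t G2 := by
        rw [← map_mul, ← hG2]
      rw [e1] at hw1
      rw [e2] at hGx
      linear_combination (-Polynomial.aeval t G2) * hw1 + Polynomial.aeval t b2 * w * hGx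
    obtain ⟨c, hc⟩ := (hG' G2).1 h1
    have : G * 1 = G * (D2 * c) := by
      calc G * 1 = D2 * G2 := by rw [mul_one]; exact hG2
        _ = D2 * (G * c) := by rw [← hc]
        _ = _ := by ring
    exact IsUnit.of_mul_eq_one _ (mul_left_cancel₀ hG0 this).symm
  obtain ⟨α, β, hαβ⟩ := hcop2
  have hαβt := congrArg (Polynomial.aeval t) hαβ
  simp only [map_add, map_mul, map_one] at hαβt
  refine ⟨(α * a') % G, lt_of_lt_of_le (EuclideanDomain.mod_lt _ hG0) hdeg,
    sG * (Polynomial.aeval t ((α * a') / G) + Polynomial.aeval t β * y),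
    S.mul_mem hsG (S.add_mem (hpol _) (S.mul_mem (hpol _) hy)), ?_⟩
  have hmod := congrArg (Polynomial.aeval t) (EuclideanDomain.div_add_mod (α * a') G)
  simp only [map_add, map_mul] at hmod
  linear_combination (-y) * hαβt + hmod * (-1) + Polynomial.aeval t α * hy' +
    (Polynomial.aeval t ((α * a') / G) + Polynomial.aeval t β * y) * hGx

/-- Length bound. -/
lemma aux_length {k K : Type*} [Field k] [Field K] [Algebra k K] (t : K) (S : Subalgebra k K)
    (O : Subring K) (hkO : ∀ c : k, algebraMap k K c ∈ O)
    (x : K) (I : Ideal O) (hI : ∀ y : O, (∃ s ∈ S, (y : K) = x * s) → y ∈ I) (N : ℕ)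
    (hdiv : ∀ y ∈ O, ∃ r : k[X], r.degree < N ∧ ∃ s ∈ S, y = Polynomial.aeval t r + x * s) :
    Order.krullDim (Submodule O (O ⧸ I)) ≤ (N : WithBot ℕ∞) := by
  let Ψ : Submodule O (O ⧸ I) → Submodule k (Polynomial.degreeLT k N) := fun M =>
    { carrier := {r | ∃ y : O, Ideal.Quotient.mk I y ∈ M ∧ ∃ s ∈ S,
        (y : K) = Polynomial.aeval t (r : k[X]) + x * s}
      add_mem' := by
        rintro a b ⟨y, hy, s, hs, h1⟩ ⟨y', hy', s', hs', h2⟩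
        refine ⟨y + y', by rw [map_add]; exact M.add_mem hy hy', s + s', S.add_mem hs hs', ?_⟩
        simp only [Subring.coe_add, Submodule.coe_add, map_add, h1, h2]; ring
      zero_mem' := ⟨0, by simp, 0, S.zero_mem, by simp⟩
      smul_mem' := by
        rintro c a ⟨y, hy, s, hs, h1⟩
        refine ⟨⟨algebraMap k K c, hkO c⟩ * y, ?_, c • s, S.smul_mem hs c, ?_⟩
        · exact M.smul_mem (⟨algebraMap k K c, hkO c⟩ : O) hy
        · rw [Subring.coe_mul, Submodule.coe_smul, map_smul, h1, Algebra.smul_def, Algebra.smul_def]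
          ring }
  have hΨ : ∀ M r, r ∈ Ψ M ↔ ∃ y : O, Ideal.Quotient.mk I y ∈ M ∧ ∃ s ∈ S,
        (y : K) = Polynomial.aeval t (r : k[X]) + x * s := fun M r => Iff.rfl
  have hmono : StrictMono Ψ := by
    intro M M' hlt
    refine lt_of_le_of_ne ?_ ?_
    · rintro r ⟨y, hy, h⟩
      exact ⟨y, hlt.le hy, h⟩
    · intro heq
      apply hlt.not_ge
      intro z hz
      obtain ⟨y, rfl⟩ := Ideal.Quotient.mk_surjective z
      obtain ⟨r, hr, s, hs, h⟩ := hdiv y y.2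
      have h1 : (⟨r, Polynomial.mem_degreeLT.2 hr⟩ : Polynomial.degreeLT k N) ∈ Ψ M' :=
        ⟨y, hz, s, hs, h⟩
      rw [← heq] at h1
      obtain ⟨y', hy', s', hs', h'⟩ := h1
      have h2 : y - y' ∈ I := by
        apply hI
        refine ⟨s - s', S.sub_mem hs hs', ?_⟩
        rw [AddSubgroupClass.coe_sub, h, h']; ring
      have h3 : Ideal.Quotient.mk I y = Ideal.Quotient.mk I y' := Ideal.Quotient.eq.2 h2
      rw [h3]; exact hy'
  refine (Order.krullDim_le_of_strictMono Ψ hmono).trans ?_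
  rw [← Module.coe_length]
  have : Module.Finite k (Polynomial.degreeLT k N) :=
    Module.Finite.equiv (Polynomial.degreeLTEquiv k N).symm
  rw [Module.length_eq_finrank, (Polynomial.degreeLTEquiv k N).finrank_eq]
  simp

/-- A linear bound on the Hilbert-Samuel function bounds the multiplicity. -/
lemma aux_mult {R : Type*} [CommRing R] (J : Ideal R) (c d B : ℕ)
    (hc : IsHSMultOfDimOne R J c)
    (h : ∀ n : ℕ, Order.krullDim (Submodule R (R ⧸ J ^ n)) ≤ ((n * d + B : ℕ) : WithBot ℕ∞)) :
    c ≤ d := by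
  obtain ⟨len, hlen, hlim⟩ := hc
  have h1 : ∀ n, len n ≤ n * d + B := by
    intro n
    have := h n
    rw [hlen n] at this
    exact_mod_cast this
  have h2 : Filter.Tendsto (fun n : ℕ => (d : ℝ) + (B : ℝ) / n) Filter.atTop
      (nhds ((d : ℝ) + 0)) :=
    tendsto_const_nhds.add (tendsto_const_div_atTop_nhds_zero_nat _)
  rw [add_zero] at h2
  have h3 : (c : ℝ) ≤ d := by
    refine le_of_tendsto_of_tendsto hlim h2 ?_
    filter_upwards [Filter.eventually_gt_atTop 0] with n hn
    have hn' : (0 : ℝ) < n := by exact_mod_cast hn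
    have h4 : (len n : ℝ) ≤ n * d + B := by exact_mod_cast h1 n
    rw [div_le_iff₀ hn']
    field_simp
    linarith
  exact_mod_cast h3

/-- The main estimate. -/
lemma aux_main {k K : Type*} [Field k] [Field K] [Algebra k K] (t : K) (S : Subalgebra k K)
    (O : Subring K) (hkO : ∀ c : k, algebraMap k K c ∈ O) (hOS : ∀ x ∈ O, x ∈ S)
    (htS : t ∈ S) (hSE : ∀ x ∈ S, x ∈ k⟮t⟯)
    (w : K) (hw : w ≠ 0) (hwE : w ∈ k⟮t⟯) (hwS : ∀ s ∈ S, w * s ∈ O)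
    (f : O) (hf : ¬ IsUnit f) (F : k[X]) (hF : F ≠ 0)
    (hFf : ∃ s ∈ S, Polynomial.aeval t F = (f : K) * s)
    (c : ℕ) (hc : IsHSMultOfDimOne O (nuIdeal O) c) : c ≤ F.natDegree := by
  obtain ⟨a, b, hab⟩ := (mem_adjoin_simple_iff k w).1 hwE
  have hb : Polynomial.aeval t b ≠ 0 := by
    intro h; rw [h, div_zero] at hab; exact hw hab
  have ha : a ≠ 0 := by
    rintro rfl
    simp at hab; exact hw hab
  have hab' : Polynomial.aeval t a = w * Polynomial.aeval t b := by
    rw [hab]; field_simp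
  obtain ⟨s0, hs0, hFs⟩ := hFf
  refine aux_mult _ c F.natDegree a.natDegree hc ?_
  intro n
  have hne : F ^ n * a ≠ 0 := mul_ne_zero (pow_ne_zero _ hF) ha
  refine aux_length t S O hkO ((f : K) ^ n * w) _ ?_ _ ?_
  · rintro y ⟨s, hs, hy⟩
    have : y = f ^ n * ⟨w * s, hwS s hs⟩ := by
      apply Subtype.ext
      rw [hy]; push_cast; ring
    rw [this]
    exact Ideal.mul_mem_right _ _ (Ideal.pow_mem_pow (Ideal.subset_span hf) n)
  · intro y hy
    obtain ⟨r, hr, h⟩ := aux_division t S htS hSE ((f : K) ^ n * w) (F ^ n * a) hne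
      ⟨s0 ^ n * Polynomial.aeval t b, S.mul_mem (S.pow_mem hs0 n) (aux_aeval_mem _ _ htS),
        by rw [map_mul, map_pow, hFs, hab']; ring⟩ y (hOS y hy)
    refine ⟨r, ?_, h⟩
    rw [Polynomial.degree_eq_natDegree hne, Polynomial.natDegree_mul (pow_ne_zero _ hF) ha,
      Polynomial.natDegree_pow] at hr
    exact_mod_cast hr

/-- The residue field of `O` is `k`. -/
lemma aux_residue {k K : Type*} [Field k] [IsAlgClosed k] [Field K] [Algebra k K] (t : K)
    (S : Subalgebra k K)
    (O : Subring K) (hkO : ∀ c : k, algebraMap k K c ∈ O) (hOS : ∀ x ∈ O, x ∈ S)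
    (htS : t ∈ S) (hSE : ∀ x ∈ S, x ∈ k⟮t⟯)
    (w : K) (hw : w ≠ 0) (hwE : w ∈ k⟮t⟯) (hwS : ∀ s ∈ S, w * s ∈ O)
    (f : O) (hf : ¬ IsUnit f) (hf0 : (f : K) ≠ 0) (x : O) :
    ∃ c : k, ¬ IsUnit (x - ⟨algebraMap k K c, hkO c⟩) := by
  have hxE : (f : K) * w ∈ k⟮t⟯ := mul_mem (hSE _ (hOS _ f.2)) hwE
  obtain ⟨a, b, hab⟩ := (mem_adjoin_simple_iff k _).1 hxE
  have hfw : (f : K) * w ≠ 0 := mul_ne_zero hf0 hw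
  have hb : Polynomial.aeval t b ≠ 0 := by
    intro h; rw [h, div_zero] at hab; exact hfw hab
  have ha : a ≠ 0 := by
    rintro rfl
    rw [map_zero, zero_div] at hab; exact hfw hab
  have hab' : Polynomial.aeval t a = (f : K) * w * Polynomial.aeval t b := by
    rw [hab]; field_simp
  have hdiv := aux_division t S htS hSE ((f : K) * w) a ha
    ⟨_, aux_aeval_mem _ b htS, hab'⟩
  set N := a.natDegree
  have hpow : ∀ i : Fin (N + 1), ∃ r : Polynomial.degreeLT k N, ∃ s ∈ S,
      (x : K) ^ (i : ℕ) = Polynomial.aeval t (r : k[X]) + (f : K) * w * s := by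
    intro i
    obtain ⟨r, hr, s, hs, h⟩ := hdiv ((x : K) ^ (i : ℕ)) (S.pow_mem (hOS _ x.2) _)
    refine ⟨⟨r, Polynomial.mem_degreeLT.2 ?_⟩, s, hs, h⟩
    rwa [Polynomial.degree_eq_natDegree ha] at hr
  choose r s hs hrs using hpow
  have : Module.Finite k (Polynomial.degreeLT k N) :=
    Module.Finite.equiv (Polynomial.degreeLTEquiv k N).symm
  have hnli : ¬ LinearIndependent k r := by
    intro h
    have := h.fintype_card_le_finrank
    rw [(Polynomial.degreeLTEquiv k N).finrank_eq] at this
    simp at this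
  obtain ⟨cf, hcf, i0, hi0⟩ := Fintype.not_linearIndependent_iff.1 hnli
  let H : k[X] := ∑ i : Fin (N + 1), Polynomial.monomial (i : ℕ) (cf i)
  have hH0 : H ≠ 0 := by
    intro h
    have := congrArg (fun p => Polynomial.coeff p (i0 : ℕ)) h
    simp only [H, Polynomial.finsetSum_coeff, Polynomial.coeff_monomial, Polynomial.coeff_zero,
      Fin.val_inj] at this
    rw [Finset.sum_ite_eq' Finset.univ i0] at this
    simp at this
    exact hi0 this
  have hHx : ∃ s ∈ S, Polynomial.aeval (x : K) H = (f : K) * w * s := by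
    refine ⟨∑ i, cf i • s i, S.sum_mem fun i _ => S.smul_mem (hs i) _, ?_⟩
    have h1 : ∑ i, cf i • Polynomial.aeval t (r i : k[X]) = 0 := by
      have := congrArg (fun p : Polynomial.degreeLT k N => Polynomial.aeval t (p : k[X])) hcf
      simpa [map_sum] using this
    simp only [H, map_sum, Polynomial.aeval_monomial, hrs, mul_add, Finset.sum_add_distrib]
    simp only [Algebra.smul_def] at h1
    rw [h1, zero_add, Finset.mul_sum]
    refine Finset.sum_congr rfl fun i _ => ?_
    rw [Algebra.smul_def]; ring
  obtain ⟨s1, hs1, hHs⟩ := hHx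
  by_contra hcon
  push Not at hcon
  have hsplit := IsAlgClosed.splits H
  let ι : k →+* O := (algebraMap k K).codRestrict O hkO
  have hHO : O.subtype (Polynomial.eval₂ ι x H) = Polynomial.aeval (x : K) H := by
    rw [Polynomial.hom_eval₂]; rfl
  have hunit : IsUnit (Polynomial.eval₂ ι x H) := by
    rw [hsplit.eq_prod_roots, Polynomial.eval₂_mul, Polynomial.eval₂_C]
    refine IsUnit.mul ?_ ?_
    · exact (IsUnit.mk0 _ (Polynomial.leadingCoeff_ne_zero.2 hH0)).map ι
    · have : ∀ m : Multiset k, IsUnit (Polynomial.eval₂ ι x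
          (m.map fun a => Polynomial.X - Polynomial.C a).prod) := by
        intro m
        induction m using Multiset.induction_on with
        | empty => simp
        | cons c m ih =>
          rw [Multiset.map_cons, Multiset.prod_cons, Polynomial.eval₂_mul]
          refine IsUnit.mul ?_ ih
          rw [Polynomial.eval₂_sub, Polynomial.eval₂_X, Polynomial.eval₂_C]
          exact hcon c
      exact this _
  have hprod : Polynomial.eval₂ ι x H = f * ⟨w * s1, hwS s1 hs1⟩ := by
    apply Subtype.ext
    have := hHO
    rw [hHs] at this
    rw [Subring.coe_subtype] at this
    rw [this]; push_cast; ring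
  rw [hprod] at hunit
  exact hf (isUnit_of_mul_isUnit_left hunit)

end AbstractPart


section BlowUp

/-- In a local subring, the ideal of nonunits consists of nonunits. -/
lemma nuIdeal_mem {K : Type*} [Field K] (O : Subring K) [IsLocalRing O] (x : O) :
    x ∈ nuIdeal O ↔ ¬ IsUnit x := by
  constructor
  · intro h
    have : nuIdeal O ≤ IsLocalRing.maximalIdeal O := Ideal.span_le.2 fun y hy =>
      (IsLocalRing.mem_maximalIdeal y).2 hy
    exact (IsLocalRing.mem_maximalIdeal x).1 (this h)
  · intro h
    exact Ideal.subset_span h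

/-- Elements of the blow-up ring become elements of `O` after multiplication by `f ^ r`. -/
lemma blow_bound {K : Type*} [Field K] (O : Subring K) (f : O) (hf0 : (f : K) ≠ 0)
    (hf : f ∈ nuIdeal O) (r : ℕ)
    (hr : nuIdeal O ^ (r + 1) = Ideal.span {f} * nuIdeal O ^ r)
    (b : K) (hb : b ∈ blowRing O f) : ∃ β : O, (f : K) ^ r * b = β := by
  have hP : ∃ j : ℕ, ∃ β : O, β ∈ nuIdeal O ^ j ∧ (f : K) ^ j * b = β := by
    refine Subring.closure_induction (p := fun b _ => ∃ j : ℕ, ∃ β : O, β ∈ nuIdeal O ^ j ∧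
      (f : K) ^ j * b = β) ?_ ?_ ?_ ?_ ?_ ?_ hb
    · rintro x (hx | ⟨m, hm, hx⟩)
      · exact ⟨0, ⟨x, hx⟩, by simp, by simp⟩
      · exact ⟨1, m, by simpa using hm, by simpa using hx⟩
    · exact ⟨0, 0, by simp, by simp⟩
    · exact ⟨0, 1, by simp, by simp⟩
    · rintro x y _ _ ⟨i, α, hα, h1⟩ ⟨j, β, hβ, h2⟩
      refine ⟨i + j, α * f ^ j + f ^ i * β, Ideal.add_mem _ ?_ ?_, ?_⟩
      · rw [pow_add]; exact Ideal.mul_mem_mul hα (Ideal.pow_mem_pow hf j)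
      · rw [pow_add]; exact Ideal.mul_mem_mul (Ideal.pow_mem_pow hf i) hβ
      · push_cast; rw [← h1, ← h2]; ring
    · rintro x _ ⟨i, α, hα, h1⟩
      exact ⟨i, -α, neg_mem hα, by push_cast; rw [← h1]; ring⟩
    · rintro x y _ _ ⟨i, α, hα, h1⟩ ⟨j, β, hβ, h2⟩
      refine ⟨i + j, α * β, by rw [pow_add]; exact Ideal.mul_mem_mul hα hβ, ?_⟩
      push_cast; rw [← h1, ← h2]; ring
  obtain ⟨j, β, hβ, h⟩ := hP
  have hpow : ∀ i : ℕ, nuIdeal O ^ (r + i) = Ideal.span {f ^ i} * nuIdeal O ^ r := by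
    intro i
    induction i with
    | zero => simp
    | succ i ih =>
      rw [← add_assoc, pow_succ, ih, mul_assoc, ← pow_succ, hr, ← mul_assoc,
        Ideal.span_singleton_mul_span_singleton, pow_succ]
  have h1 : f ^ r * β ∈ nuIdeal O ^ (r + j) := by
    rw [pow_add]; exact Ideal.mul_mem_mul (Ideal.pow_mem_pow hf r) hβ
  rw [hpow j, Ideal.mem_span_singleton_mul] at h1
  obtain ⟨z, hz, h2⟩ := h1
  refine ⟨z, ?_⟩
  have h3 := congrArg (fun u : O => (u : K)) h2
  push_cast at h3
  apply mul_left_cancel₀ (pow_ne_zero j hf0)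
  rw [h3, ← h]; ring

/-- The closure in the definition of `IsFirstNbhdOf` is superfluous. -/
lemma loc_mem {K : Type*} [Field K] (B : Subring K) (N : Ideal B) [hN : N.IsPrime] (x : K)
    (hx : x ∈ Subring.closure (locSet B N)) : x ∈ locSet B N := by
  have h1 : (1 : B) ∉ N := fun h => hN.ne_top ((Ideal.eq_top_iff_one N).2 h)
  refine Subring.closure_induction (p := fun b _ => b ∈ locSet B N) ?_ ?_ ?_ ?_ ?_ ?_ hx
  · exact fun x hx => hx
  · exact ⟨0, 1, h1, by simp⟩
  · exact ⟨1, 1, h1, by simp⟩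
  · rintro x y _ _ ⟨a, s, hs, h⟩ ⟨a', s', hs', h'⟩
    refine ⟨a * s' + a' * s, s * s', fun h => (hN.mem_or_mem h).elim hs hs', ?_⟩
    push_cast; rw [← h, ← h']; ring
  · rintro x _ ⟨a, s, hs, h⟩
    exact ⟨-a, s, hs, by push_cast; rw [← h]; ring⟩
  · rintro x y _ _ ⟨a, s, hs, h⟩ ⟨a', s', hs', h'⟩
    refine ⟨a * a', s * s', fun h => (hN.mem_or_mem h).elim hs hs', ?_⟩
    push_cast; rw [← h, ← h']; ring

lemma ne_zero_of_notMem {K : Type*} [Field K] {B : Subring K} {N : Ideal B} {s : B} (hs : s ∉ N) :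
    (s : K) ≠ 0 := by
  intro h
  apply hs
  have : s = 0 := Subtype.ext h
  rw [this]; exact N.zero_mem

lemma blow_step {K : Type*} [Field K] (E : Subfield K) (O O1 : Subring K) [IsLocalRing O]
    (h : IsFirstNbhdOf O O1) :
    IsLocalRing O1 ∧ O ≤ O1 ∧
    (∀ x : O, ¬ IsUnit x → ∀ y ∈ O1, (x : K) * y ≠ 1) ∧
    (O1 = ⊤ ∨
      ((O ≤ E.toSubring → O1 ≤ E.toSubring) ∧
        ∃ f : O, ¬ IsUnit f ∧ (f : K) ≠ 0 ∧ ∀ m : O, ¬ IsUnit m → (m : K) / f ∈ O1)) := by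
  obtain ⟨f, hf, ⟨r, hr⟩, N, hN, rfl⟩ := h
  have hNp : N.IsPrime := hN.isPrime
  have h1 : (1 : blowRing O f) ∉ N := fun h => hNp.ne_top ((Ideal.eq_top_iff_one N).2 h)
  have hfm : f ∈ nuIdeal O := (nuIdeal_mem O f).2 hf
  have hOB : O ≤ blowRing O f := fun x hx => Subring.subset_closure (Or.inl hx)
  have hBO1 : ∀ x ∈ blowRing O f, x ∈ Subring.closure (locSet (blowRing O f) N) := by
    intro x hx
    exact Subring.subset_closure ⟨⟨x, hx⟩, 1, h1, by simp⟩
  have hblow : ∀ m : O, ¬ IsUnit m → (f : K) ≠ 0 → (m : K) / f ∈ blowRing O f := by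
    intro m hm hf0
    exact Subring.subset_closure (Or.inr ⟨m, (nuIdeal_mem O m).2 hm, by field_simp⟩)
  -- f ∈ N
  have hfN : (⟨f, hOB f.2⟩ : blowRing O f) ∈ N := by
    by_cases hf0 : (f : K) = 0
    · have : (⟨f, hOB f.2⟩ : blowRing O f) = 0 := Subtype.ext hf0
      rw [this]; exact N.zero_mem
    by_contra hcon
    obtain ⟨b, n, hn, hbn⟩ := hN.exists_inv hcon
    obtain ⟨β, hβ⟩ := blow_bound O f hf0 hfm r hr ((b : K) ^ (r + 1))
      ((blowRing O f).pow_mem b.2 _)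
    have hu : IsUnit (1 - f * β) := by
      have h2 : ¬ IsUnit (f * β) := fun h => hf (isUnit_of_mul_isUnit_left h)
      rcases IsLocalRing.isUnit_or_isUnit_one_sub_self (f * β) with h3 | h3
      · exact absurd h3 h2
      · exact h3
    obtain ⟨v, hv⟩ := hu.exists_right_inv
    have hvK := congrArg (fun u : O => (u : K)) hv
    push_cast at hvK
    set c : blowRing O f := b * ⟨f, hOB f.2⟩ with hc
    have hgeom := geom_sum_mul_neg c (r + 1)
    have hn1 : n = 1 - c := by rw [← hbn]; ring
    apply h1
    have h4 : (1 : blowRing O f) =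
        ((∑ i ∈ Finset.range (r + 1), c ^ i) * ⟨v, hOB v.2⟩) * n := by
      have h5 : (1 - c ^ (r + 1)) * ⟨v, hOB v.2⟩ = 1 := by
        apply Subtype.ext
        push_cast
        rw [hc]
        push_cast
        rw [← hβ] at hvK
        linear_combination hvK
      rw [← h5, ← hgeom, hn1]; ring
    rw [h4]
    exact N.mul_mem_left _ hn
  have hmN : ∀ x : O, ¬ IsUnit x → (⟨x, hOB x.2⟩ : blowRing O f) ∈ N := by
    intro x hx
    by_cases hf0 : (f : K) = 0
    · have hf0' : f = 0 := Subtype.ext hf0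
      rw [hf0'] at hr
      have : nuIdeal O ^ (r + 1) = ⊥ := by rw [hr]; simp
      have h2 : nuIdeal O = ⊥ := by
        have h3 : nuIdeal O ^ (r + 1) = 0 := this
        exact pow_eq_zero_iff (Nat.succ_ne_zero r) |>.1 h3
      have h3 : x ∈ nuIdeal O := (nuIdeal_mem O x).2 hx
      rw [h2, Ideal.mem_bot] at h3
      have : (⟨x, hOB x.2⟩ : blowRing O f) = 0 := Subtype.ext (by rw [h3]; rfl)
      rw [this]; exact N.zero_mem
    · have : (⟨x, hOB x.2⟩ : blowRing O f) =
          ⟨(x : K) / f, hblow x hx hf0⟩ * ⟨f, hOB f.2⟩ := by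
        apply Subtype.ext
        push_cast
        field_simp
      rw [this]
      exact N.mul_mem_left _ hfN
  refine ⟨?_, fun x hx => hBO1 x (hOB hx), ?_, ?_⟩
  · refine IsLocalRing.of_isUnit_or_isUnit_one_sub_self ?_
    rintro ⟨x, hx⟩
    obtain ⟨a, s, hs, hax⟩ := loc_mem _ N x hx
    have hs0 := ne_zero_of_notMem hs
    by_cases ha : a ∈ N
    · right
      have hsa : s - a ∉ N := fun h => hs (by
        have := N.add_mem h ha
        rwa [sub_add_cancel] at this)
      have hsa0 := ne_zero_of_notMem hsa
      push_cast at hsa0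
      refine IsUnit.of_mul_eq_one ⟨(s : K) / ((s : K) - a), Subring.subset_closure
        ⟨s, s - a, hsa, by push_cast; field_simp⟩⟩ ?_
      apply Subtype.ext
      push_cast
      rw [← hax] at hsa0 ⊢
      rw [← mul_div_assoc, div_eq_one_iff_eq hsa0]
      ring
    · left
      have ha0 := ne_zero_of_notMem ha
      refine IsUnit.of_mul_eq_one ⟨(s : K) / a, Subring.subset_closure
        ⟨s, a, ha, by field_simp⟩⟩ ?_
      apply Subtype.ext
      push_cast
      rw [← mul_div_assoc, mul_comm x, hax]
      field_simp
  · intro x hx y hy hxy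
    obtain ⟨a, s, hs, hay⟩ := loc_mem _ N y hy
    apply hs
    have : s = a * ⟨x, hOB x.2⟩ := by
      apply Subtype.ext
      push_cast
      rw [← hay, mul_assoc, mul_comm y, hxy, mul_one]
    rw [this]
    exact N.mul_mem_left _ (hmN x hx)
  · by_cases hf0 : (f : K) = 0
    · left
      rw [eq_top_iff]
      intro x _
      apply hBO1
      exact Subring.subset_closure (Or.inr ⟨0, Ideal.zero_mem _, by simp [hf0]⟩)
    · right
      refine ⟨?_, f, hf, hf0, fun m hm => hBO1 _ (hblow m hm hf0)⟩
      intro hOE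
      have hBE : blowRing O f ≤ E.toSubring := by
        refine Subring.closure_le.2 ?_
        rintro x (hx | ⟨m, hm, hx⟩)
        · exact hOE hx
        · have : x = (m : K) / f := by rw [← hx]; field_simp
          rw [this]
          exact E.div_mem (hOE m.2) (hOE f.2)
      intro x hx
      obtain ⟨a, s, hs, hax⟩ := loc_mem _ N x hx
      have hs0 := ne_zero_of_notMem hs
      have : x = (a : K) / s := by rw [← hax]; field_simp
      rw [this]
      exact E.div_mem (hBE a.2) (hBE s.2)

/-- The chain of blow-ups. -/
lemma blow_chain {K : Type*} [Field K] (E : Subfield K) (O O' : Subring K) [IsLocalRing O]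
    (hOE : O ≤ E.toSubring) (h : IsInfinitelyNearTo O O') :
    O' = ⊤ ∨ (IsLocalRing O' ∧ O ≤ O' ∧ O' ≤ E.toSubring ∧
      (∀ x : O, ¬ IsUnit x → ∀ y ∈ O', (x : K) * y ≠ 1) ∧
      ∃ f : O, ¬ IsUnit f ∧ (f : K) ≠ 0 ∧ ∀ m : O, ¬ IsUnit m → (m : K) / f ∈ O') := by
  have key : (IsLocalRing O' ∧ O ≤ O' ∧ (∀ x : O, ¬ IsUnit x → ∀ y ∈ O', (x : K) * y ≠ 1)) ∧
    (O' = ⊤ ∨ (O' ≤ E.toSubring ∧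
      ∃ f : O, ¬ IsUnit f ∧ (f : K) ≠ 0 ∧ ∀ m : O, ¬ IsUnit m → (m : K) / f ∈ O')) := by
    unfold IsInfinitelyNearTo at h
    induction h with
    | single h1 =>
      obtain ⟨h2, h3, h4, h5⟩ := blow_step E O _ h1
      exact ⟨⟨h2, h3, h4⟩, h5.imp id fun h => ⟨h.1 hOE, h.2⟩⟩
    | tail _ h1 ih =>
      obtain ⟨⟨i1, i2, i3⟩, i4⟩ := ih
      obtain ⟨h2, h3, h4, h5⟩ := blow_step E _ _ h1
      refine ⟨⟨h2, i2.trans h3, ?_⟩, ?_⟩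
      · intro x hx
        refine h4 ⟨x, i2 x.2⟩ ?_
        intro hu
        obtain ⟨v, hv⟩ := hu.exists_right_inv
        exact i3 x hx v v.2 (congrArg Subtype.val hv)
      · rcases i4 with i4 | ⟨i4, f, hf, hf0, i5⟩
        · left
          rw [eq_top_iff, ← i4]
          exact h3
        · rcases h5 with h5 | h5
          · exact Or.inl h5
          · exact Or.inr ⟨h5.1 i4, f, hf, hf0, fun m hm => h3 (i5 m hm)⟩
  obtain ⟨⟨i1, i2, i3⟩, i4 | ⟨i4, i5⟩⟩ := key
  · exact Or.inl i4
  · exact Or.inr ⟨i1, i2, i4, i3, i5⟩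

/-- The whole field has multiplicity zero. -/
lemma top_mult {K : Type*} [Field K] (c : ℕ)
    (hc : IsHSMultOfDimOne (⊤ : Subring K) (nuIdeal (⊤ : Subring K)) c) : c = 0 := by
  refine Nat.le_zero.1 (aux_mult _ c 0 1 hc ?_)
  intro n
  have hs : IsSimpleModule (⊤ : Subring K) (⊤ : Subring K) := by
    rw [isSimpleModule_self_iff_isUnit]
    refine ⟨inferInstance, fun x hx => ?_⟩
    have hx' : (x : K) ≠ 0 := fun h => hx (Subtype.ext h)
    exact IsUnit.of_mul_eq_one ⟨(x : K)⁻¹, trivial⟩ (Subtype.ext (mul_inv_cancel₀ hx'))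
  rw [← Module.coe_length]
  have h1 := Module.length_le_of_surjective
    (Submodule.mkQ (nuIdeal (⊤ : Subring K) ^ n)) (Submodule.mkQ_surjective _)
  rw [Module.length_eq_one (⊤ : Subring K) (⊤ : Subring K)] at h1
  have h2 : ((Module.length (⊤ : Subring K)
    ((⊤ : Subring K) ⧸ nuIdeal (⊤ : Subring K) ^ n) : ℕ∞) : WithBot ℕ∞) ≤ ((1 : ℕ∞) : WithBot ℕ∞) :=
    WithBot.coe_le_coe.2 h1
  simpa using h2

end BlowUp


section Geometry

open Polynomial IntermediateField

/-- The ring `O[t]`. -/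
noncomputable def adjT {k K : Type*} [Field k] [Field K] [Algebra k K] (t : K) (O : Subring K)
    (hkO : ∀ c : k, algebraMap k K c ∈ O) : Subalgebra k K :=
  { (Polynomial.eval₂RingHom O.subtype t).range with
    algebraMap_mem' := fun c => ⟨Polynomial.C ⟨algebraMap k K c, hkO c⟩, by simp⟩ }

lemma mem_adjT {k K : Type*} [Field k] [Field K] [Algebra k K] (t : K) (O : Subring K)
    (hkO : ∀ c : k, algebraMap k K c ∈ O) (x : K) :
    x ∈ adjT t O hkO ↔ ∃ q : Polynomial O, Polynomial.eval₂ O.subtype t q = x := Iff.rfl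

/-- The conductor. -/
lemma adjT_conductor {k K : Type*} [Field k] [Field K] [Algebra k K] (t : K) (O0 O : Subring K)
    (hkO : ∀ c : k, algebraMap k K c ∈ O) (hO : O0 ≤ O)
    (p : Polynomial O0) (hp : p.Monic) (hpt : Polynomial.eval₂ O0.subtype t p = 0)
    (w : K) (hw : w ∈ O) (hwt : w * t ∈ O) (s : K) (hs : s ∈ adjT t O hkO) :
    w ^ p.natDegree * s ∈ O := by
  obtain ⟨q, rfl⟩ := (mem_adjT t O hkO s).1 hs
  set P : Polynomial O := p.map (Subring.inclusion hO) with hP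
  have hPm : P.Monic := hp.map _
  have hPt : Polynomial.eval₂ O.subtype t P = 0 := by
    rw [hP, Polynomial.eval₂_map]
    exact hpt
  have hPd : P.natDegree = p.natDegree := hp.natDegree_map _
  have hq : Polynomial.eval₂ O.subtype t q = Polynomial.eval₂ O.subtype t (q %ₘ P) := by
    conv_lhs => rw [← Polynomial.modByMonic_add_div q P]
    rw [Polynomial.eval₂_add, Polynomial.eval₂_mul, hPt, zero_mul, add_zero]
  have hd : (q %ₘ P).natDegree < p.natDegree + 1 := by
    rw [← hPd]
    exact Nat.lt_succ_of_le (Polynomial.natDegree_modByMonic_le q hPm)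
  rw [hq, Polynomial.eval₂_eq_sum_range' _ hd, Finset.mul_sum]
  refine O.sum_mem fun i hi => ?_
  have hi' : i ≤ p.natDegree := Nat.lt_succ_iff.1 (Finset.mem_range.1 hi)
  have : w ^ p.natDegree * (O.subtype ((q %ₘ P).coeff i) * t ^ i) =
      w ^ (p.natDegree - i) * (w * t) ^ i * ((q %ₘ P).coeff i : O) := by
    conv_lhs => rw [← Nat.sub_add_cancel hi']
    rw [Subring.coe_subtype]; ring
  rw [this]
  exact O.mul_mem (O.mul_mem (O.pow_mem hw _) (O.pow_mem hwt _)) (SetLike.coe_mem _)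

lemma aux_indep {k : Type*} [Field k] (G0 G1 G2 p0 p1 p2 : k[X]) (a1 a2 : k)
    (hG : ∀ c0 c1 c2 : k, Polynomial.C c0 * G0 + Polynomial.C c1 * G1 + Polynomial.C c2 * G2 = 0 →
      c0 = 0 ∧ c1 = 0 ∧ c2 = 0)
    (hsyz : G0 * p0 + G1 * p1 + G2 * p2 = 0)
    (hp : ¬ (p0 = 0 ∧ p1 = 0 ∧ p2 = 0))
    (h0 : p0 + Polynomial.C a1 * p1 + Polynomial.C a2 * p2 = 0)
    (l1 l2 : k) (hl : Polynomial.C l1 * p1 + Polynomial.C l2 * p2 = 0) : l1 = 0 ∧ l2 = 0 := by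
  by_contra hcon
  have hpp : ¬ (p1 = 0 ∧ p2 = 0) := by
    rintro ⟨rfl, rfl⟩
    apply hp
    simpa using h0
  -- the vanishing linear combination
  have key : ∀ e : k[X], e ≠ 0 →
      (Polynomial.C (a2 * l1 - a1 * l2) * G0 + Polynomial.C l2 * G1 + Polynomial.C (-l1) * G2) * e = 0
      → False := by
    intro e he h
    rcases mul_eq_zero.1 h with h | h
    · obtain ⟨_, h1, h2⟩ := hG _ _ _ h
      exact hcon ⟨by simpa using h2, h1⟩
    · exact he h
  have hp0 : p0 = - (Polynomial.C a1 * p1 + Polynomial.C a2 * p2) := by linear_combination h0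
  by_cases h1 : p1 = 0
  · have h2 : p2 ≠ 0 := fun h => hpp ⟨h1, h⟩
    refine key p2 h2 ?_
    rw [h1, mul_zero, zero_add] at hl
    simp only [map_sub, map_mul, map_neg]
    rw [hp0, h1] at hsyz
    linear_combination (- Polynomial.C l1) * hsyz + (G1 - Polynomial.C a1 * G0) * hl
  · refine key p1 h1 ?_
    simp only [map_sub, map_mul, map_neg]
    rw [hp0] at hsyz
    linear_combination (Polynomial.C l2) * hsyz + (Polynomial.C a2 * G0 - G2) * hl

lemma geom_main {k K : Type*} [Field k] [IsAlgClosed k] [Field K] [Algebra k K] (t : K)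
    (O0 O' : Subring K) [IsLocalRing O0]
    (hkO : ∀ c : k, algebraMap k K c ∈ O0)
    (hOE : O0 ≤ (k⟮t⟯).toSubfield.toSubring)
    (G0 G1 G2 p0 p1 p2 : k[X]) (a1 a2 : k) (z1 z2 : K)
    (hG0 : Polynomial.aeval t G0 ≠ 0)
    (hz1 : z1 * Polynomial.aeval t G0 = Polynomial.aeval t G1)
    (hz2 : z2 * Polynomial.aeval t G0 = Polynomial.aeval t G2)
    (hz1O : z1 ∈ O0) (hz2O : z2 ∈ O0)
    (hy1 : ∀ y ∈ O0, (z1 - algebraMap k K a1) * y ≠ 1)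
    (hy2 : ∀ y ∈ O0, (z2 - algebraMap k K a2) * y ≠ 1)
    (hgen : ∀ x : O0, ¬ IsUnit x → ∃ o1 ∈ O0, ∃ o2 ∈ O0,
      (x : K) = o1 * (z1 - algebraMap k K a1) + o2 * (z2 - algebraMap k K a2))
    (hG : ∀ c0 c1 c2 : k, Polynomial.C c0 * G0 + Polynomial.C c1 * G1 + Polynomial.C c2 * G2 = 0 →
      c0 = 0 ∧ c1 = 0 ∧ c2 = 0)
    (hsyz : G0 * p0 + G1 * p1 + G2 * p2 = 0)
    (hp : ¬ (p0 = 0 ∧ p1 = 0 ∧ p2 = 0))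
    (d₁ : ℕ) (hd0 : p0.natDegree ≤ d₁) (hd1 : p1.natDegree ≤ d₁) (hd2 : p2.natDegree ≤ d₁)
    (P : Polynomial O0) (hP : P.Monic) (hPt : Polynomial.eval₂ O0.subtype t P = 0)
    (w : K) (hw0 : w ≠ 0) (hw : w ∈ O0) (hwt : w * t ∈ O0)
    (hnear : IsInfinitelyNearTo O0 O')
    (c : ℕ) (hc : IsHSMultOfDimOne O' (nuIdeal O') c) : c ≤ d₁ := by
  have hCdeg : ∀ (l : k) (q : k[X]), q.natDegree ≤ d₁ → (Polynomial.C l * q).natDegree ≤ d₁ :=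
    fun l q h => (Polynomial.natDegree_C_mul_le l q).trans h
  rcases blow_chain _ O0 O' hOE hnear with rfl | ⟨hloc, hle, hE, hnu, f0, hf0u, hf0, hx⟩
  · rw [top_mult c hc]; exact Nat.zero_le _
  have hkO' : ∀ c : k, algebraMap k K c ∈ O' := fun c => hle (hkO c)
  set S := adjT t O' hkO' with hS
  have hOS : ∀ x ∈ O', x ∈ S := fun x hx =>
    (mem_adjT t O' hkO' x).2 ⟨Polynomial.C ⟨x, hx⟩, by simp⟩
  have htS : t ∈ S := (mem_adjT t O' hkO' t).2 ⟨Polynomial.X, by simp⟩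
  have hSE : ∀ x ∈ S, x ∈ k⟮t⟯ := by
    intro x hx
    obtain ⟨q, rfl⟩ := (mem_adjT t O' hkO' x).1 hx
    rw [Polynomial.eval₂_eq_sum_range]
    exact sum_mem fun i _ => mul_mem (hE (SetLike.coe_mem (q.coeff i)))
      (pow_mem (mem_adjoin_simple_self k t) i)
  have hpS : ∀ q : k[X], Polynomial.aeval t q ∈ S := fun q => aux_aeval_mem S q htS
  set W := w ^ P.natDegree with hW
  have hW0 : W ≠ 0 := pow_ne_zero _ hw0
  have hWE : W ∈ k⟮t⟯ := hE (O'.pow_mem (hle hw) _)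
  have hWS : ∀ s ∈ S, W * s ∈ O' := fun s hs =>
    adjT_conductor t O0 O' hkO' hle P hP hPt w (hle hw) (hle hwt) s hs
  -- elements of the first neighborhood
  have hm : ∀ y ∈ O0, (∀ y' ∈ O0, y * y' ≠ 1) → y / f0 ∈ O' := by
    intro y hy h
    refine hx ⟨y, hy⟩ ?_
    intro hu
    obtain ⟨v, hv⟩ := hu.exists_right_inv
    exact h v v.2 (congrArg Subtype.val hv)
  have hx1 := hm _ (O0.sub_mem hz1O (hkO a1)) hy1
  have hx2 := hm _ (O0.sub_mem hz2O (hkO a2)) hy2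
  set x1 := (z1 - algebraMap k K a1) / (f0 : K) with hx1d
  set x2 := (z2 - algebraMap k K a2) / (f0 : K) with hx2d
  have e1 : z1 = algebraMap k K a1 + f0 * x1 := by rw [hx1d]; field_simp; ring
  have e2 : z2 = algebraMap k K a2 + f0 * x2 := by rw [hx2d]; field_simp; ring
  have hf0n : ¬ IsUnit (⟨f0, hle f0.2⟩ : O') := by
    intro hu
    obtain ⟨v, hv⟩ := hu.exists_right_inv
    exact hnu f0 hf0u v v.2 (congrArg Subtype.val hv)
  have hsyzt : Polynomial.aeval t p0 + z1 * Polynomial.aeval t p1 + z2 * Polynomial.aeval t p2 = 0 := by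
    have := congrArg (Polynomial.aeval t) hsyz
    simp only [map_add, map_mul, map_zero] at this
    apply mul_left_cancel₀ hG0
    rw [mul_zero]
    linear_combination this + Polynomial.aeval t p1 * hz1 + Polynomial.aeval t p2 * hz2
  by_cases hA : p0 + Polynomial.C a1 * p1 + Polynomial.C a2 * p2 = 0
  · -- the point has multiplicity > d₁
    have hAt := congrArg (Polynomial.aeval t) hA
    simp only [map_add, map_mul, map_zero, Polynomial.aeval_C] at hAt
    have hxx : x1 * Polynomial.aeval t p1 + x2 * Polynomial.aeval t p2 = 0 := by
      apply mul_left_cancel₀ hf0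
      rw [e1, e2] at hsyzt
      linear_combination hsyzt - hAt
    obtain ⟨o1, ho1, o2, ho2, hfo⟩ := hgen f0 hf0u
    have hone : o1 * x1 + o2 * x2 = 1 := by
      rw [e1, e2] at hfo
      apply mul_left_cancel₀ hf0
      linear_combination - hfo
    obtain ⟨l1, hl1⟩ := aux_residue t S O' hkO' hOS htS hSE W hW0 hWE hWS ⟨f0, hle f0.2⟩ hf0n hf0
      ⟨x1, hx1⟩
    obtain ⟨l2, hl2⟩ := aux_residue t S O' hkO' hOS htS hSE W hW0 hWE hWS ⟨f0, hle f0.2⟩ hf0n hf0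
      ⟨x2, hx2⟩
    have hl1' := (IsLocalRing.mem_maximalIdeal _).2 hl1
    have hl2' := (IsLocalRing.mem_maximalIdeal _).2 hl2
    have hF : Polynomial.C l1 * p1 + Polynomial.C l2 * p2 ≠ 0 := by
      intro h
      obtain ⟨rfl, rfl⟩ := aux_indep G0 G1 G2 p0 p1 p2 a1 a2 hG hsyz hp hA l1 l2 h
      have h1 := Ideal.add_mem _ (Ideal.mul_mem_left _ ⟨o1, hle ho1⟩ hl1')
        (Ideal.mul_mem_left _ ⟨o2, hle ho2⟩ hl2')
      apply (IsLocalRing.mem_maximalIdeal _).1 h1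
      convert isUnit_one
      apply Subtype.ext
      push_cast
      simp only [map_zero, sub_zero]
      exact hone
    have hfm : (⟨algebraMap k K l2, hkO' l2⟩ * ⟨x1, hx1⟩ - ⟨algebraMap k K l1, hkO' l1⟩ * ⟨x2, hx2⟩ : O')
        ∈ IsLocalRing.maximalIdeal O' := by
      have h1 := Ideal.sub_mem _ (Ideal.mul_mem_left _ ⟨algebraMap k K l2, hkO' l2⟩ hl1')
        (Ideal.mul_mem_left _ ⟨algebraMap k K l1, hkO' l1⟩ hl2')
      convert h1 using 1
      ring
    refine (aux_main t S O' hkO' hOS htS hSE W hW0 hWE hWS _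
      ((IsLocalRing.mem_maximalIdeal _).1 hfm) _ hF ?_ c hc).trans ?_
    · refine ⟨o1 * Polynomial.aeval t p2 - o2 * Polynomial.aeval t p1,
        S.sub_mem (S.mul_mem (hOS _ (hle ho1)) (hpS _)) (S.mul_mem (hOS _ (hle ho2)) (hpS _)), ?_⟩
      simp only [map_add, map_mul, Polynomial.aeval_C]
      push_cast
      set A := Polynomial.aeval t p1
      set B := Polynomial.aeval t p2
      linear_combination (-(algebraMap k K l2 * B) - algebraMap k K l1 * A) * hone +
        (algebraMap k K l2 * o2 + algebraMap k K l1 * o1) * hxx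
    · exact (Polynomial.natDegree_add_le _ _).trans (max_le (hCdeg _ _ hd1) (hCdeg _ _ hd2))
  · -- the point has multiplicity ≤ d₁
    refine (aux_main t S O' hkO' hOS htS hSE W hW0 hWE hWS ⟨f0, hle f0.2⟩ hf0n _ hA ?_ c hc).trans ?_
    · refine ⟨- (x1 * Polynomial.aeval t p1 + x2 * Polynomial.aeval t p2),
        S.neg_mem (S.add_mem (S.mul_mem (hOS _ hx1) (hpS _)) (S.mul_mem (hOS _ hx2) (hpS _))), ?_⟩
      simp only [map_add, map_mul, Polynomial.aeval_C]
      rw [e1, e2] at hsyzt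
      linear_combination hsyzt
    · exact (Polynomial.natDegree_add_le _ _).trans (max_le ((Polynomial.natDegree_add_le _ _).trans
        (max_le hd0 (hCdeg _ _ hd1))) (hCdeg _ _ hd2))

end Geometry


section Concrete

open MvPolynomial

/-- Scaling the arguments of a form. -/
lemma hom_scale {σ k B : Type*} [Field k] [CommRing B] [Algebra k B] (G : MvPolynomial σ k) (e : ℕ)
    (hG : G.IsHomogeneous e) (s : B) (v : σ → B) :
    MvPolynomial.aeval (fun i => s * v i) G = s ^ e * MvPolynomial.aeval v G := by
  rw [MvPolynomial.aeval_def, MvPolynomial.aeval_def, MvPolynomial.eval₂_eq,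
    MvPolynomial.eval₂_eq, Finset.mul_sum]
  refine Finset.sum_congr rfl fun m hm => ?_
  have hdeg : ∑ i ∈ m.support, m i = e := by
    have := hG (MvPolynomial.mem_support_iff.1 hm)
    rw [Finsupp.weight_apply] at this
    simpa [Finsupp.sum] using this
  simp only [mul_pow, Finset.prod_mul_distrib, Finset.prod_pow_eq_pow_sum, hdeg]
  ring

/-- Dehomogenization along the line spanned by `u` and `v`. -/
noncomputable def deh {k : Type*} [Field k] (u v : Fin 2 → k) :
    MvPolynomial (Fin 2) k →ₐ[k] Polynomial k :=
  MvPolynomial.aeval fun i => Polynomial.C (u i) * Polynomial.X + Polynomial.C (v i)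

lemma deh_coeff {k : Type*} [Field k] (u v : Fin 2 → k) (G : MvPolynomial (Fin 2) k) (e : ℕ)
    (hG : G.IsHomogeneous e) :
    (deh u v G).natDegree ≤ e ∧ (deh u v G).coeff e = MvPolynomial.eval u G := by
  have hlin : ∀ i, (Polynomial.C (u i) * Polynomial.X + Polynomial.C (v i)).natDegree ≤ 1 :=
    fun i => Polynomial.natDegree_linear_le
  have hmon : ∀ m ∈ G.support, (∏ i : Fin 2,
      (Polynomial.C (u i) * Polynomial.X + Polynomial.C (v i)) ^ m i).natDegree ≤ e ∧
      (∏ i : Fin 2,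
      (Polynomial.C (u i) * Polynomial.X + Polynomial.C (v i)) ^ m i).coeff e =
        ∏ i, u i ^ m i := by
    intro m hm
    have hdeg : m 0 + m 1 = e := by
      have := hG (MvPolynomial.mem_support_iff.1 hm)
      rw [Finsupp.weight_apply, Finsupp.sum_fintype _ _ (by simp)] at this
      simpa [Fin.sum_univ_two] using this
    have h1 : ∀ i n, ((Polynomial.C (u i) * Polynomial.X + Polynomial.C (v i)) ^ n).natDegree ≤ n :=
      fun i n => (Polynomial.natDegree_pow_le_of_le n (hlin i)).trans (by simp)
    have h2 : ∀ i n, ((Polynomial.C (u i) * Polynomial.X + Polynomial.C (v i)) ^ n).coeff n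
        = u i ^ n := by
      intro i n
      have := Polynomial.coeff_pow_of_natDegree_le (m := n) (hlin i)
      simpa using this
    rw [Fin.prod_univ_two, Fin.prod_univ_two, ← hdeg]
    refine ⟨Polynomial.natDegree_mul_le_of_le (h1 0 _) (h1 1 _), ?_⟩
    rw [Polynomial.coeff_mul_add_eq_of_natDegree_le (h1 0 _) (h1 1 _), h2, h2]
  have hexp : deh u v G = ∑ m ∈ G.support, Polynomial.C (MvPolynomial.coeff m G) * ∏ i : Fin 2,
      (Polynomial.C (u i) * Polynomial.X + Polynomial.C (v i)) ^ m i := by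
    rw [deh, MvPolynomial.aeval_def, MvPolynomial.eval₂_eq']
    rfl
  rw [hexp]
  constructor
  · refine Polynomial.natDegree_sum_le_of_forall_le _ _ fun m hm => ?_
    exact (Polynomial.natDegree_C_mul_le _ _).trans (hmon m hm).1
  · rw [Polynomial.finsetSum_coeff, MvPolynomial.eval_eq']
    refine Finset.sum_congr rfl fun m hm => ?_
    rw [Polynomial.coeff_C_mul, (hmon m hm).2]

/-- A form is recovered from its dehomogenization. -/
lemma deh_key {k L : Type*} [Field k] [Field L] [Algebra k L] [Algebra (MvPolynomial (Fin 2) k) L]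
    [IsScalarTower k (MvPolynomial (Fin 2) k) L] (u v : Fin 2 → k) (l2 τ : L)
    (hl : ∀ i, algebraMap (MvPolynomial (Fin 2) k) L (X i) =
      l2 * (algebraMap k L (u i) * τ + algebraMap k L (v i)))
    (G : MvPolynomial (Fin 2) k) (e : ℕ) (hG : G.IsHomogeneous e) :
    algebraMap (MvPolynomial (Fin 2) k) L G = l2 ^ e * Polynomial.aeval τ (deh u v G) := by
  have h1 : Polynomial.aeval τ (deh u v G) =
      MvPolynomial.aeval (fun i => algebraMap k L (u i) * τ + algebraMap k L (v i)) G := by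
    have : ((Polynomial.aeval τ).comp (deh u v)) =
        MvPolynomial.aeval (fun i => algebraMap k L (u i) * τ + algebraMap k L (v i)) := by
      apply MvPolynomial.algHom_ext
      intro i
      simp [deh]
    rw [← this]; rfl
  have h2 : algebraMap (MvPolynomial (Fin 2) k) L G = MvPolynomial.aeval
      (fun i => l2 * (algebraMap k L (u i) * τ + algebraMap k L (v i))) G := by
    have : IsScalarTower.toAlgHom k (MvPolynomial (Fin 2) k) L = MvPolynomial.aeval
      (fun i => l2 * (algebraMap k L (u i) * τ + algebraMap k L (v i))) := by
      apply MvPolynomial.algHom_ext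
      intro i
      simp [hl]
    rw [← this]; rfl
  rw [h1, h2]
  exact hom_scale G e hG _ _

lemma comp_sum {k : Type*} [Field k] (a : ℕ → MvPolynomial (Fin 2) k) (D : ℕ → ℕ)
    (hD : Function.Injective D) (ha : ∀ m, (a m).IsHomogeneous (D m)) (N m0 : ℕ) :
    MvPolynomial.homogeneousComponent (D m0) (∑ m ∈ Finset.range N, a m) =
      if m0 < N then a m0 else 0 := by
  rw [map_sum]
  have : ∀ m ∈ Finset.range N, MvPolynomial.homogeneousComponent (D m0) (a m) =
      if m = m0 then a m0 else 0 := by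
    intro m _
    rw [MvPolynomial.homogeneousComponent_of_mem (ha m)]
    by_cases h : m = m0
    · simp [h]
    · have h2 : D m0 ≠ D m := fun h' => h (hD h').symm
      simp [h, h2]
  rw [Finset.sum_congr rfl this, Finset.sum_ite_eq' ]
  simp [Finset.mem_range]

lemma aeval_hom {k : Type*} [Field k] (d : ℕ) (g : Fin 3 → MvPolynomial (Fin 2) k)
    (hg : ∀ i, (g i).IsHomogeneous d) (Φ : MvPolynomial (Fin 3) k) (m : ℕ)
    (hΦ : Φ.IsHomogeneous m) : (MvPolynomial.aeval g Φ).IsHomogeneous (d * m) := by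
  exact hΦ.aeval _ hg

lemma mem_cone {k : Type*} [Field k] (g : Fin 3 → MvPolynomial (Fin 2) k)
    (x : MvPolynomial (Fin 2) k) : x ∈ coneRing g ↔ ∃ Φ : MvPolynomial (Fin 3) k, MvPolynomial.aeval g Φ = x := by
  rw [coneRing, Algebra.adjoin_range_eq_range_aeval]; rfl

/-- Homogeneous elements of the cone ring are forms in the `g i`. -/
lemma cone_hom {k : Type*} [Field k] (d : ℕ) (hd : 0 < d) (g : Fin 3 → MvPolynomial (Fin 2) k)
    (hg : ∀ i, (g i).IsHomogeneous d) (s : MvPolynomial (Fin 2) k) (hs : s ∈ coneRing g)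
    (e : ℕ) (he : s.IsHomogeneous e) (hs0 : s ≠ 0) :
    ∃ (m : ℕ) (Φ : MvPolynomial (Fin 3) k), Φ.IsHomogeneous m ∧ e = d * m ∧
      s = MvPolynomial.aeval g Φ := by
  obtain ⟨H, rfl⟩ := (mem_cone g s).1 hs
  have hhom : ∀ m,
      (MvPolynomial.aeval g (MvPolynomial.homogeneousComponent m H)).IsHomogeneous (d * m) :=
    fun m => aeval_hom d g hg _ m (MvPolynomial.homogeneousComponent_isHomogeneous m H)
  have hexp : MvPolynomial.aeval g H = ∑ m ∈ Finset.range (H.totalDegree + 1),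
      MvPolynomial.aeval g (MvPolynomial.homogeneousComponent m H) := by
    conv_lhs => rw [← MvPolynomial.sum_homogeneousComponent H]
    rw [map_sum]
  have hself : MvPolynomial.homogeneousComponent e (MvPolynomial.aeval g H) =
      MvPolynomial.aeval g H := by
    rw [MvPolynomial.homogeneousComponent_of_mem he, if_pos rfl]
  have hDinj : Function.Injective fun m => d * m := by
    intro m n h
    exact Nat.eq_of_mul_eq_mul_left hd h
  have hne : ∑ m ∈ Finset.range (H.totalDegree + 1), MvPolynomial.homogeneousComponent e
      (MvPolynomial.aeval g (MvPolynomial.homogeneousComponent m H)) ≠ 0 := by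
    rw [← map_sum, ← hexp, hself]; exact hs0
  obtain ⟨m, hm, hm0⟩ := Finset.exists_ne_zero_of_sum_ne_zero hne
  have hem : e = d * m := by
    by_contra h
    apply hm0
    rw [MvPolynomial.homogeneousComponent_of_mem (hhom m), if_neg h]
  refine ⟨m, _, MvPolynomial.homogeneousComponent_isHomogeneous m H, hem, ?_⟩
  have h := comp_sum (fun m => MvPolynomial.aeval g (MvPolynomial.homogeneousComponent m H))
    (fun m => d * m) hDinj hhom (H.totalDegree + 1) m
  rw [← hexp, if_pos (Finset.mem_range.1 hm)] at h
  subst hem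
  exact hself.symm.trans h

/-- Comparing components. -/
lemma cone_ratio {k : Type*} [Field k] (d : ℕ) (hd : 0 < d) (g : Fin 3 → MvPolynomial (Fin 2) k)
    (hg : ∀ i, (g i).IsHomogeneous d) (l1 l2 : MvPolynomial (Fin 2) k)
    (hl1 : l1.IsHomogeneous 1) (hl2 : l2.IsHomogeneous 1)
    (x y : MvPolynomial (Fin 2) k) (hx : x ∈ coneRing g) (hy : y ∈ coneRing g) (hy0 : y ≠ 0)
    (hxy : l2 * x = l1 * y) :
    ∃ (m : ℕ) (x' y' : MvPolynomial (Fin 2) k), x' ∈ coneRing g ∧ y' ∈ coneRing g ∧ y' ≠ 0 ∧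
      x'.IsHomogeneous (d * m) ∧ y'.IsHomogeneous (d * m) ∧ l2 * x' = l1 * y' := by
  obtain ⟨F, rfl⟩ := (mem_cone g x).1 hx
  obtain ⟨H, rfl⟩ := (mem_cone g y).1 hy
  set N := max (F.totalDegree + 1) (H.totalDegree + 1) with hN
  have hexp : ∀ Φ : MvPolynomial (Fin 3) k, Φ.totalDegree + 1 ≤ N → MvPolynomial.aeval g Φ =
      ∑ m ∈ Finset.range N, MvPolynomial.aeval g (MvPolynomial.homogeneousComponent m Φ) := by
    intro Φ hΦ
    conv_lhs => rw [← MvPolynomial.sum_homogeneousComponent Φ]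
    rw [map_sum]
    refine Finset.sum_subset (Finset.range_subset_range.2 hΦ) ?_
    intro m _ hm
    rw [MvPolynomial.homogeneousComponent_eq_zero, map_zero]
    simpa using hm
  have hF := hexp F (le_max_left _ _)
  have hH := hexp H (le_max_right _ _)
  have hDinj : Function.Injective fun m => d * m + 1 := by
    intro m n h
    have h' : d * m = d * n := by simpa using h
    exact Nat.eq_of_mul_eq_mul_left hd h'
  have hhom : ∀ (Φ : MvPolynomial (Fin 3) k) m,
      (MvPolynomial.aeval g (MvPolynomial.homogeneousComponent m Φ)).IsHomogeneous (d * m) :=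
    fun Φ m => aeval_hom d g hg _ m (MvPolynomial.homogeneousComponent_isHomogeneous m Φ)
  have hsum : ∑ m ∈ Finset.range N,
      (l2 * MvPolynomial.aeval g (MvPolynomial.homogeneousComponent m F) -
       l1 * MvPolynomial.aeval g (MvPolynomial.homogeneousComponent m H)) = 0 := by
    rw [Finset.sum_sub_distrib, ← Finset.mul_sum, ← Finset.mul_sum, ← hF, ← hH, hxy, sub_self]
  obtain ⟨m, hm, hm0⟩ := Finset.exists_ne_zero_of_sum_ne_zero (hH ▸ hy0)
  refine ⟨m, _, _, (mem_cone g _).2 ⟨_, rfl⟩, (mem_cone g _).2 ⟨_, rfl⟩, hm0, hhom F m, hhom H m, ?_⟩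
  have h := comp_sum (fun m => l2 * MvPolynomial.aeval g (MvPolynomial.homogeneousComponent m F) -
       l1 * MvPolynomial.aeval g (MvPolynomial.homogeneousComponent m H)) (fun m => d * m + 1) hDinj
       (fun m => by
        rw [add_comm]
        exact (hl2.mul (hhom F m)).sub (hl1.mul (hhom H m))) N m
  rw [hsum, map_zero, if_pos (Finset.mem_range.1 hm)] at h
  exact sub_eq_zero.1 h.symm

end Concrete


section LocalRing

open MvPolynomial

lemma cone_ne_zero {k : Type*} [Field k] {g : Fin 3 → MvPolynomial (Fin 2) k} {q : Fin 2 → k}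
    {s : coneRing g} (hs : eval q (s : MvPolynomial (Fin 2) k) ≠ 0) :
    algebraMap (coneRing g) (FractionRing (coneRing g)) s ≠ 0 := by
  intro h
  have h1 : s = 0 := (IsFractionRing.injective (coneRing g) (FractionRing (coneRing g)))
    (by rw [h, map_zero])
  rw [h1] at hs
  simp at hs

lemma point_eval {k : Type*} [Field k] (g : Fin 3 → MvPolynomial (Fin 2) k) (a : Fin 3 → k)
    (q : Fin 2 → k) (T : k) (ha : ∀ i, a i = T * eval q (g i)) (s : coneRing g)
    (hs : s ∈ pointIdeal g a) : eval q (s : MvPolynomial (Fin 2) k) = 0 := by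
  let ev : coneRing g →+* k := (eval q).comp (coneRing g).val.toRingHom
  have : pointIdeal g a ≤ RingHom.ker ev := by
    refine Ideal.span_le.2 ?_
    rintro x ⟨i, j, rfl⟩
    change eval q ((a i • coneGen g j - a j • coneGen g i : coneRing g) : MvPolynomial (Fin 2) k) = 0
    have : ((a i • coneGen g j - a j • coneGen g i : coneRing g) : MvPolynomial (Fin 2) k) =
      a i • g j - a j • g i := rfl
    rw [this, map_sub, smul_eval, smul_eval, ha i, ha j]
    ring
  exact this hs

/-- A form in the generators dies in any quotient killing the relations of the point. -/
lemma point_kill {k B : Type*} [Field k] [CommRing B] [Algebra k B] (γ : Fin 3 → B)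
    (b : Fin 3 → k) (i0 : Fin 3) (hi0 : b i0 ≠ 0)
    (h : ∀ j, algebraMap k B (b i0) * γ j = algebraMap k B (b j) * γ i0)
    (Φ : MvPolynomial (Fin 3) k) (m : ℕ) (hΦ : Φ.IsHomogeneous m) (hb : eval b Φ = 0) :
    MvPolynomial.aeval γ Φ = 0 := by
  have h3 : γ = fun j => (γ i0 * algebraMap k B (b i0)⁻¹) * algebraMap k B (b j) := by
    funext j
    have h4 : algebraMap k B (b i0)⁻¹ * algebraMap k B (b i0) = 1 := by
      rw [← map_mul, inv_mul_cancel₀ hi0, map_one]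
    linear_combination (-(γ j)) * h4 + algebraMap k B (b i0)⁻¹ * h j
  rw [h3, hom_scale Φ m hΦ]
  have h6 : MvPolynomial.aeval (fun j => algebraMap k B (b j)) Φ
      = algebraMap k B (eval b Φ) := by
    exact MvPolynomial.aeval_algebraMap_apply (B := B) b Φ
  rw [h6, hb, map_zero, mul_zero]

lemma eval_comp {k : Type*} [Field k] (g : Fin 3 → MvPolynomial (Fin 2) k) (q : Fin 2 → k)
    (Φ : MvPolynomial (Fin 3) k) :
    eval q (MvPolynomial.aeval g Φ) = eval (fun i => eval q (g i)) Φ := by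
  induction Φ using MvPolynomial.induction_on with
  | C c => simp
  | add p r hp hr => rw [map_add, map_add, map_add, hp, hr]
  | mul_X p i hp =>
    rw [map_mul, map_mul, map_mul, hp, MvPolynomial.aeval_X, MvPolynomial.eval_X]

lemma point_kill2 {k B : Type*} [Field k] [CommRing B] [Algebra k B] (I : Ideal B) (γ : Fin 3 → B)
    (b : Fin 3 → k) (i0 : Fin 3) (hi0 : b i0 ≠ 0)
    (h : ∀ j, algebraMap k B (b i0) * γ j - algebraMap k B (b j) * γ i0 ∈ I)
    (Φ : MvPolynomial (Fin 3) k) (m : ℕ) (hΦ : Φ.IsHomogeneous m) (hb : eval b Φ = 0) :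
    MvPolynomial.aeval γ Φ ∈ I := by
  rw [← Ideal.Quotient.eq_zero_iff_mem]
  let π : B →ₐ[k] (B ⧸ I) := Ideal.Quotient.mkₐ k I
  change π _ = 0
  have h7 : π (MvPolynomial.aeval γ Φ) = MvPolynomial.aeval (fun i => π (γ i)) Φ :=
    MvPolynomial.comp_aeval_apply γ π Φ
  rw [h7]
  refine point_kill _ b i0 hi0 ?_ Φ m hΦ hb
  intro j
  have h4 : π (algebraMap k B (b i0) * γ j - algebraMap k B (b j) * γ i0) = 0 :=
    Ideal.Quotient.eq_zero_iff_mem.2 (h j)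
  rw [map_sub, map_mul, map_mul, AlgHom.commutes, AlgHom.commutes] at h4
  exact sub_eq_zero.1 h4

lemma point_mem {k : Type*} [Field k] (d : ℕ) (hd : 0 < d) (g : Fin 3 → MvPolynomial (Fin 2) k)
    (hg : ∀ i, (g i).IsHomogeneous d) (a : Fin 3 → k)
    (q : Fin 2 → k) (T : k) (hT : T ≠ 0) (ha : ∀ i, a i = T * eval q (g i))
    (i0 : Fin 3) (hi0 : a i0 ≠ 0) (s : coneRing g) (e : ℕ)
    (he : (s : MvPolynomial (Fin 2) k).IsHomogeneous e)
    (hs : eval q (s : MvPolynomial (Fin 2) k) = 0) : s ∈ pointIdeal g a := by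
  by_cases hs0 : (s : MvPolynomial (Fin 2) k) = 0
  · have : s = 0 := Subtype.ext hs0
    rw [this]; exact Ideal.zero_mem _
  obtain ⟨m, Φ, hΦ, -, hsΦ⟩ := cone_hom d hd g hg s s.2 e he hs0
  have h1 : s = MvPolynomial.aeval (coneGen g) Φ := by
    apply Subtype.ext
    have h2 : (coneRing g).val (MvPolynomial.aeval (coneGen g) Φ) =
        MvPolynomial.aeval (fun i => (coneRing g).val (coneGen g i)) Φ := by
      rw [← MvPolynomial.comp_aeval_apply]
    rw [hsΦ]
    exact h2.symm
  have h2 : eval a Φ = 0 := by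
    have h3 := hom_scale Φ m hΦ T (fun i => eval q (g i))
    have h4 : a = fun i => T * eval q (g i) := funext ha
    have h5 : eval (fun i => eval q (g i)) Φ = 0 := by
      rw [← eval_comp, ← hsΦ]; exact hs
    have h6 : ∀ b : Fin 3 → k, MvPolynomial.aeval b Φ = eval b Φ := fun b => rfl
    rw [h6, h6, h5, mul_zero] at h3
    rw [h4]; exact h3
  rw [h1]
  refine point_kill2 _ _ a i0 hi0 ?_ Φ m hΦ h2
  intro j
  refine Ideal.subset_span ⟨i0, j, ?_⟩
  rw [Algebra.smul_def, Algebra.smul_def]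

/-- Elements of the local ring are fractions. -/
lemma mem_local {k : Type*} [Field k] (d : ℕ) (hd : 0 < d) (g : Fin 3 → MvPolynomial (Fin 2) k)
    (hg : ∀ i, (g i).IsHomogeneous d) (a : Fin 3 → k)
    (q : Fin 2 → k) (T : k) (hT : T ≠ 0) (ha : ∀ i, a i = T * eval q (g i))
    (i0 : Fin 3) (hi0 : a i0 ≠ 0) (x : FractionRing (coneRing g)) :
    x ∈ curveLocalRing g a ↔ ∃ f s : coneRing g, ∃ e : ℕ,
        ((f : MvPolynomial (Fin 2) k).IsHomogeneous e) ∧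
        ((s : MvPolynomial (Fin 2) k).IsHomogeneous e) ∧
        eval q (s : MvPolynomial (Fin 2) k) ≠ 0 ∧
        algebraMap (coneRing g) (FractionRing (coneRing g)) s * x =
          algebraMap (coneRing g) (FractionRing (coneRing g)) f := by
  constructor
  · intro hx
    refine Subring.closure_induction (p := fun x _ => ∃ f s : coneRing g, ∃ e : ℕ,
        ((f : MvPolynomial (Fin 2) k).IsHomogeneous e) ∧
        ((s : MvPolynomial (Fin 2) k).IsHomogeneous e) ∧
        eval q (s : MvPolynomial (Fin 2) k) ≠ 0 ∧
        algebraMap (coneRing g) (FractionRing (coneRing g)) s * x =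
          algebraMap (coneRing g) (FractionRing (coneRing g)) f) ?_ ?_ ?_ ?_ ?_ ?_ hx
    · rintro x ⟨f, s, e, hf, hs, hsp, h⟩
      exact ⟨f, s, e, hf, hs, fun h0 =>
        hsp (point_mem d hd g hg a q T hT ha i0 hi0 s e hs h0), h⟩
    · exact ⟨0, 1, 0, isHomogeneous_zero _ _ _, isHomogeneous_one _ _, by simp, by simp⟩
    · exact ⟨1, 1, 0, isHomogeneous_one _ _, isHomogeneous_one _ _, by simp, by simp⟩
    · rintro x y _ _ ⟨f, s, e, hf, hs, hsp, h⟩ ⟨f', s', e', hf', hs', hsp', h'⟩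
      refine ⟨f * s' + s * f', s * s', e + e', (hf.mul hs').add (hs.mul hf'), hs.mul hs', ?_, ?_⟩
      · push_cast; rw [map_mul]; exact mul_ne_zero hsp hsp'
      · rw [map_add, map_mul, map_mul, map_mul, ← h, ← h']; ring
    · rintro x _ ⟨f, s, e, hf, hs, hsp, h⟩
      exact ⟨-f, s, e, hf.neg, hs, hsp, by rw [map_neg, ← h]; ring⟩
    · rintro x y _ _ ⟨f, s, e, hf, hs, hsp, h⟩ ⟨f', s', e', hf', hs', hsp', h'⟩
      refine ⟨f * f', s * s', e + e', hf.mul hf', hs.mul hs', ?_, ?_⟩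
      · push_cast; rw [map_mul]; exact mul_ne_zero hsp hsp'
      · rw [map_mul, map_mul, ← h, ← h']; ring
  · rintro ⟨f, s, e, hf, hs, hsp, h⟩
    exact Subring.subset_closure ⟨f, s, e, hf, hs, fun h0 => hsp (point_eval g a q T ha s h0), h⟩

lemma local_unit {k : Type*} [Field k] (d : ℕ) (hd : 0 < d) (g : Fin 3 → MvPolynomial (Fin 2) k)
    (hg : ∀ i, (g i).IsHomogeneous d) (a : Fin 3 → k)
    (q : Fin 2 → k) (T : k) (hT : T ≠ 0) (ha : ∀ i, a i = T * eval q (g i))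
    (i0 : Fin 3) (hi0 : a i0 ≠ 0) (x : curveLocalRing g a) (f s : coneRing g) (e : ℕ)
    (hf : (f : MvPolynomial (Fin 2) k).IsHomogeneous e)
    (hs : (s : MvPolynomial (Fin 2) k).IsHomogeneous e)
    (hfq : eval q (f : MvPolynomial (Fin 2) k) ≠ 0)
    (hsq : eval q (s : MvPolynomial (Fin 2) k) ≠ 0)
    (h : algebraMap (coneRing g) (FractionRing (coneRing g)) s * x =
          algebraMap (coneRing g) (FractionRing (coneRing g)) f) : IsUnit x := by
  have hf0 := cone_ne_zero hfq
  have hs0 := cone_ne_zero hsq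
  refine IsUnit.of_mul_eq_one ⟨algebraMap (coneRing g) (FractionRing (coneRing g)) s /
    algebraMap (coneRing g) (FractionRing (coneRing g)) f,
    (mem_local d hd g hg a q T hT ha i0 hi0 _).2 ⟨s, f, e, hs, hf, hfq, by field_simp⟩⟩ ?_
  apply Subtype.ext
  rw [Subring.coe_mul, ← mul_div_assoc, mul_comm (x : FractionRing (coneRing g)), h]
  exact div_self hf0

lemma local_isLocal {k : Type*} [Field k] (d : ℕ) (hd : 0 < d) (g : Fin 3 → MvPolynomial (Fin 2) k)
    (hg : ∀ i, (g i).IsHomogeneous d) (a : Fin 3 → k)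
    (q : Fin 2 → k) (T : k) (hT : T ≠ 0) (ha : ∀ i, a i = T * eval q (g i))
    (i0 : Fin 3) (hi0 : a i0 ≠ 0) : IsLocalRing (curveLocalRing g a) := by
  refine IsLocalRing.of_isUnit_or_isUnit_one_sub_self ?_
  intro x
  obtain ⟨f, s, e, hf, hs, hsq, h⟩ := (mem_local d hd g hg a q T hT ha i0 hi0 x).1 x.2
  by_cases hfq : eval q (f : MvPolynomial (Fin 2) k) = 0
  · right
    refine local_unit d hd g hg a q T hT ha i0 hi0 (1 - x) (s - f) s e (hs.sub hf) hs ?_ hsq ?_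
    · push_cast; rw [map_sub, hfq, sub_zero]; exact hsq
    · rw [show ((1 - x : curveLocalRing g a) : FractionRing (coneRing g)) = 1 - x from rfl,
        map_sub, ← h]; ring
  · left
    exact local_unit d hd g hg a q T hT ha i0 hi0 x f s e hf hs hfq hsq h

/-- Taylor expansion to first order. -/
lemma taylor {k K : Type*} [Field k] [Field K] [Algebra k K] (O : Subring K)
    (hkO : ∀ c : k, algebraMap k K c ∈ O) (z : Fin 3 → K) (b : Fin 3 → k)
    (hz : ∀ i, z i ∈ O) (y1 y2 : K)
    (hy : ∀ i, ∃ o1 ∈ O, ∃ o2 ∈ O, z i - algebraMap k K (b i) = o1 * y1 + o2 * y2)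
    (Φ : MvPolynomial (Fin 3) k) :
    ∃ o1 ∈ O, ∃ o2 ∈ O, MvPolynomial.aeval z Φ - algebraMap k K (eval b Φ) = o1 * y1 + o2 * y2 := by
  induction Φ using MvPolynomial.induction_on with
  | C c => exact ⟨0, O.zero_mem, 0, O.zero_mem, by simp⟩
  | add p q hp hq =>
    obtain ⟨o1, h1, o2, h2, h⟩ := hp
    obtain ⟨o1', h1', o2', h2', h'⟩ := hq
    refine ⟨o1 + o1', O.add_mem h1 h1', o2 + o2', O.add_mem h2 h2', ?_⟩
    simp only [map_add]
    linear_combination h + h'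
  | mul_X p i hp =>
    obtain ⟨o1, h1, o2, h2, h⟩ := hp
    obtain ⟨o1', h1', o2', h2', h'⟩ := hy i
    refine ⟨o1 * z i + algebraMap k K (eval b p) * o1',
      O.add_mem (O.mul_mem h1 (hz i)) (O.mul_mem (hkO _) h1'),
      o2 * z i + algebraMap k K (eval b p) * o2',
      O.add_mem (O.mul_mem h2 (hz i)) (O.mul_mem (hkO _) h2'), ?_⟩
    simp only [map_mul, MvPolynomial.aeval_X, MvPolynomial.eval_X]
    linear_combination z i * h + algebraMap k K (eval b p) * h'

end LocalRing


section Final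

open MvPolynomial

lemma frame {k : Type*} [Field k] (u v : Fin 2 → k) (huv : u 0 * v 1 - u 1 * v 0 = 1) :
    ∃ l1 l2 : MvPolynomial (Fin 2) k, l1.IsHomogeneous 1 ∧ l2.IsHomogeneous 1 ∧ l2 ≠ 0 ∧
      ∀ i, (X i : MvPolynomial (Fin 2) k) = C (u i) * l1 + C (v i) * l2 := by
  have hC : ∀ (c : k) (i : Fin 2), (C c * X i : MvPolynomial (Fin 2) k).IsHomogeneous 1 := by
    intro c i
    have := (isHomogeneous_C (Fin 2) c).mul (isHomogeneous_X k i)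
    simpa using this
  have hC1 : (C (u 0) * C (v 1) - C (u 1) * C (v 0) : MvPolynomial (Fin 2) k) = 1 := by
    rw [← C_mul, ← C_mul, ← C_sub, huv, C_1]
  refine ⟨C (v 1) * X 0 - C (v 0) * X 1, C (u 0) * X 1 - C (u 1) * X 0, (hC _ _).sub (hC _ _),
    (hC _ _).sub (hC _ _), ?_, ?_⟩
  · intro h
    have h1 := congrArg (eval v) h
    simp at h1
    rw [h1] at huv
    exact zero_ne_one huv
  · intro i
    fin_cases i
    · simp only [Fin.zero_eta, Fin.isValue]
      linear_combination (-(X 0 : MvPolynomial (Fin 2) k)) * hC1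
    · simp only [Fin.mk_one, Fin.isValue]
      linear_combination (-(X 1 : MvPolynomial (Fin 2) k)) * hC1

lemma frame_tau {k : Type*} [Field k] (u v : Fin 2 → k) (l1 l2 : MvPolynomial (Fin 2) k)
    (hl20 : l2 ≠ 0)
    (hX : ∀ i, (X i : MvPolynomial (Fin 2) k) = C (u i) * l1 + C (v i) * l2)
    (G : MvPolynomial (Fin 2) k) (e : ℕ) (hG : G.IsHomogeneous e) :
    algebraMap (MvPolynomial (Fin 2) k) (FractionRing (MvPolynomial (Fin 2) k)) l2 ≠ 0 ∧
    algebraMap (MvPolynomial (Fin 2) k) (FractionRing (MvPolynomial (Fin 2) k)) G =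
      algebraMap (MvPolynomial (Fin 2) k) (FractionRing (MvPolynomial (Fin 2) k)) l2 ^ e *
      Polynomial.aeval
        (algebraMap (MvPolynomial (Fin 2) k) (FractionRing (MvPolynomial (Fin 2) k)) l1 /
        algebraMap (MvPolynomial (Fin 2) k) (FractionRing (MvPolynomial (Fin 2) k)) l2)
        (deh u v G) := by
  have h0 : algebraMap (MvPolynomial (Fin 2) k) (FractionRing (MvPolynomial (Fin 2) k)) l2 ≠ 0 :=
    fun h => hl20 (IsFractionRing.injective (MvPolynomial (Fin 2) k)
      (FractionRing (MvPolynomial (Fin 2) k)) (by rw [h, map_zero]))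
  refine ⟨h0, deh_key u v _ _ ?_ G e hG⟩
  intro i
  have hc : ∀ c : k, algebraMap (MvPolynomial (Fin 2) k) (FractionRing (MvPolynomial (Fin 2) k)) (C c)
      = algebraMap k (FractionRing (MvPolynomial (Fin 2) k)) c := fun c =>
    (IsScalarTower.algebraMap_apply k (MvPolynomial (Fin 2) k) _ c).symm
  rw [hX i, map_add, map_mul, map_mul, hc, hc]
  field_simp

lemma deh_inj {k : Type*} [Field k] (u v : Fin 2 → k) (huv : u 0 * v 1 - u 1 * v 0 = 1)
    (G : MvPolynomial (Fin 2) k) (e : ℕ) (hG : G.IsHomogeneous e) (h : deh u v G = 0) : G = 0 := by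
  obtain ⟨l1, l2, -, -, h20, hX⟩ := frame u v huv
  have := (frame_tau u v l1 l2 h20 hX G e hG).2
  rw [h, map_zero, mul_zero] at this
  exact IsFractionRing.injective (MvPolynomial (Fin 2) k)
      (FractionRing (MvPolynomial (Fin 2) k)) (by rw [this, map_zero])

lemma exists_t {k : Type*} [Field k] (d : ℕ) (hd : 0 < d) (g : Fin 3 → MvPolynomial (Fin 2) k)
    (hg : ∀ i, (g i).IsHomogeneous d)
    (hbir : ∀ v ∈ Algebra.adjoin k {f : MvPolynomial (Fin 2) k | f.IsHomogeneous d},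
      ∃ x ∈ Algebra.adjoin k (Set.range g), ∃ y ∈ Algebra.adjoin k (Set.range g),
        y ≠ 0 ∧ y * v = x)
    (u v : Fin 2 → k) (huv : u 0 * v 1 - u 1 * v 0 = 1) :
    ∃ t : FractionRing (coneRing g),
      (∃ (m : ℕ) (x y : coneRing g), y ≠ 0 ∧
        (x : MvPolynomial (Fin 2) k).IsHomogeneous (d * m) ∧
        (y : MvPolynomial (Fin 2) k).IsHomogeneous (d * m) ∧
        algebraMap (coneRing g) (FractionRing (coneRing g)) y * t =
          algebraMap (coneRing g) (FractionRing (coneRing g)) x) ∧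
      (∀ (f s : coneRing g) (e : ℕ), (f : MvPolynomial (Fin 2) k).IsHomogeneous e →
        (s : MvPolynomial (Fin 2) k).IsHomogeneous e →
        algebraMap (coneRing g) (FractionRing (coneRing g)) f *
          Polynomial.aeval t (deh u v (s : MvPolynomial (Fin 2) k)) =
        algebraMap (coneRing g) (FractionRing (coneRing g)) s *
          Polynomial.aeval t (deh u v (f : MvPolynomial (Fin 2) k))) ∧
      (∀ (s : coneRing g) (e : ℕ), (s : MvPolynomial (Fin 2) k).IsHomogeneous e → s ≠ 0 →
          Polynomial.aeval t (deh u v (s : MvPolynomial (Fin 2) k)) ≠ 0) := by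
  obtain ⟨l1, l2, hl1, hl2, hl20, hX⟩ := frame u v huv
  have hmem : ∃ x ∈ coneRing g, ∃ y ∈ coneRing g, y ≠ 0 ∧ l2 * x = l1 * y := by
    obtain ⟨x, hx, y, hy, hy0, h⟩ := hbir (l1 * l2 ^ (d - 1)) (Algebra.subset_adjoin (by
      have := hl1.mul (hl2.pow (d - 1))
      rwa [one_mul, show 1 + (d - 1) = d by omega] at this))
    obtain ⟨x', hx', y', hy', hy0', h'⟩ := hbir (l2 ^ d) (Algebra.subset_adjoin (by
      have := hl2.pow d
      rwa [one_mul] at this))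
    refine ⟨x * y', mul_mem hx hy', y * x', mul_mem hy hx', ?_, ?_⟩
    · rw [← h']
      exact mul_ne_zero hy0 (mul_ne_zero hy0' (pow_ne_zero _ hl20))
    · rw [← h, ← h']
      obtain ⟨n, rfl⟩ : ∃ n, d = n + 1 := ⟨d - 1, by omega⟩
      simp only [Nat.add_sub_cancel]
      ring
  obtain ⟨x0, hx0, y0, hy0, hy00, hxy0⟩ := hmem
  obtain ⟨m, x, y, hx, hy, hyne, hxh, hyh, hxy⟩ :=
    cone_ratio d hd g hg l1 l2 hl1 hl2 x0 y0 hx0 hy0 hy00 hxy0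
  have hinj : Function.Injective ((IsScalarTower.toAlgHom k (MvPolynomial (Fin 2) k)
      (FractionRing (MvPolynomial (Fin 2) k))).comp (coneRing g).val) := by
    intro a b hab
    exact Subtype.ext (IsFractionRing.injective (MvPolynomial (Fin 2) k)
      (FractionRing (MvPolynomial (Fin 2) k)) hab)
  let j : FractionRing (coneRing g) →ₐ[k] FractionRing (MvPolynomial (Fin 2) k) :=
    IsFractionRing.liftAlgHom hinj
  have hj : ∀ s : coneRing g, j (algebraMap (coneRing g) (FractionRing (coneRing g)) s) =
      algebraMap (MvPolynomial (Fin 2) k) (FractionRing (MvPolynomial (Fin 2) k))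
        (s : MvPolynomial (Fin 2) k) := fun s => IsFractionRing.lift_algebraMap hinj s
  have hjinj : Function.Injective j := j.toRingHom.injective
  have hyK : algebraMap (coneRing g) (FractionRing (coneRing g)) ⟨y, hy⟩ ≠ 0 := by
    intro h
    have h1 : (⟨y, hy⟩ : coneRing g) = 0 :=
      (IsFractionRing.injective (coneRing g) (FractionRing (coneRing g))) (by rw [h, map_zero])
    exact hyne (congrArg Subtype.val h1)
  have hyL : algebraMap (MvPolynomial (Fin 2) k) (FractionRing (MvPolynomial (Fin 2) k)) y ≠ 0 := by
    rw [← hj ⟨y, hy⟩]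
    exact fun h => hyK (hjinj (by rw [h, map_zero]))
  have hl2L := (frame_tau u v l1 l2 hl20 hX 0 0 (isHomogeneous_zero _ _ _)).1
  set t : FractionRing (coneRing g) := algebraMap (coneRing g) (FractionRing (coneRing g)) ⟨x, hx⟩ /
    algebraMap (coneRing g) (FractionRing (coneRing g)) ⟨y, hy⟩ with ht
  have hjt : j t = algebraMap (MvPolynomial (Fin 2) k) (FractionRing (MvPolynomial (Fin 2) k)) l1 /
        algebraMap (MvPolynomial (Fin 2) k) (FractionRing (MvPolynomial (Fin 2) k)) l2 := by
    rw [ht, map_div₀, hj, hj, div_eq_div_iff hyL hl2L, ← map_mul, ← map_mul]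
    congr 1
    change x * l2 = l1 * y
    rw [mul_comm, hxy]
  have hje : ∀ F : Polynomial k, j (Polynomial.aeval t F) = Polynomial.aeval (
      algebraMap (MvPolynomial (Fin 2) k) (FractionRing (MvPolynomial (Fin 2) k)) l1 /
        algebraMap (MvPolynomial (Fin 2) k) (FractionRing (MvPolynomial (Fin 2) k)) l2) F := by
    intro F
    rw [← hjt, Polynomial.aeval_algHom_apply]
  refine ⟨t, ⟨m, ⟨x, hx⟩, ⟨y, hy⟩, fun h => hyne (congrArg Subtype.val h), hxh, hyh, ?_⟩, ?_, ?_⟩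
  · rw [ht, mul_div_cancel₀ _ hyK]
  · intro f s e hf hs
    apply hjinj
    rw [map_mul, map_mul, hje, hje, hj, hj, (frame_tau u v l1 l2 hl20 hX _ e hf).2,
      (frame_tau u v l1 l2 hl20 hX _ e hs).2]
    ring
  · intro s e hs hs0 h
    have h1 := congrArg j h
    rw [hje, map_zero] at h1
    have h2 := (frame_tau u v l1 l2 hl20 hX _ e hs).2
    rw [h1, mul_zero] at h2
    apply hs0
    apply Subtype.ext
    exact IsFractionRing.injective (MvPolynomial (Fin 2) k)
      (FractionRing (MvPolynomial (Fin 2) k)) (by rw [h2]; simp)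

lemma pick_three : ∀ i0 : Fin 3, ∃ i1 i2 : Fin 3, i1 ≠ i0 ∧ i2 ≠ i0 ∧ i1 ≠ i2 ∧
    ∀ i, i = i0 ∨ i = i1 ∨ i = i2 := by decide

lemma sum_three {M : Type*} [AddCommMonoid M] (i0 i1 i2 : Fin 3) (h1 : i1 ≠ i0) (h2 : i2 ≠ i0)
    (h3 : i1 ≠ i2) (F : Fin 3 → M) : ∑ i, F i = F i0 + F i1 + F i2 := by
  rw [Fin.sum_univ_three]
  fin_cases i0 <;> fin_cases i1 <;> fin_cases i2 <;> simp_all <;> abel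

lemma pick_v {k : Type*} [Field k] (u : Fin 2 → k) (hu : u ≠ 0) :
    ∃ v : Fin 2 → k, u 0 * v 1 - u 1 * v 0 = 1 := by
  by_cases h : u 0 = 0
  · have h1 : u 1 ≠ 0 := by
      intro h1
      apply hu
      funext i
      fin_cases i
      · exact h
      · exact h1
    refine ⟨![-(u 1)⁻¹, 0], ?_⟩
    simp [h1]
  · refine ⟨![0, (u 0)⁻¹], ?_⟩
    simp [h]

end Final

section Final2

open MvPolynomial

/-- The embedding of the cone ring in its fraction field. -/
noncomputable abbrev al {k : Type*} [Field k] (g : Fin 3 → MvPolynomial (Fin 2) k) :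
    coneRing g →+* FractionRing (coneRing g) := algebraMap (coneRing g) (FractionRing (coneRing g))

lemma al_ne {k : Type*} [Field k] (g : Fin 3 → MvPolynomial (Fin 2) k) (s : coneRing g)
    (hs : s ≠ 0) : al g s ≠ 0 := fun h =>
  hs ((IsFractionRing.injective (coneRing g) (FractionRing (coneRing g))) (by
    rw [map_zero]; exact h))

lemma al_k {k : Type*} [Field k] (g : Fin 3 → MvPolynomial (Fin 2) k) (c : k) :
    al g (algebraMap k (coneRing g) c) = algebraMap k (FractionRing (coneRing g)) c :=
  (IsScalarTower.algebraMap_apply k (coneRing g) (FractionRing (coneRing g)) c).symm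

lemma al_aeval {k : Type*} [Field k] (g : Fin 3 → MvPolynomial (Fin 2) k)
    (Φ : MvPolynomial (Fin 3) k) (s : coneRing g)
    (hs : (s : MvPolynomial (Fin 2) k) = MvPolynomial.aeval g Φ) :
    al g s = MvPolynomial.aeval (fun i => al g (coneGen g i)) Φ := by
  have h1 : s = MvPolynomial.aeval (coneGen g) Φ := by
    apply Subtype.ext
    have h2 : (coneRing g).val (MvPolynomial.aeval (coneGen g) Φ) =
        MvPolynomial.aeval (fun i => (coneRing g).val (coneGen g i)) Φ := by
      rw [← MvPolynomial.comp_aeval_apply]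
    rw [hs]
    exact h2.symm
  rw [h1]
  exact (MvPolynomial.aeval_algebraMap_apply (FractionRing (coneRing g)) (coneGen g) Φ).symm

lemma k_mem {k : Type*} [Field k] (g : Fin 3 → MvPolynomial (Fin 2) k) (a : Fin 3 → k)
    (q : Fin 2 → k) (T : k) (ha : ∀ i, a i = T * eval q (g i)) (c : k) :
    algebraMap k (FractionRing (coneRing g)) c ∈ curveLocalRing g a := by
  refine Subring.subset_closure ⟨algebraMap k (coneRing g) c, 1, 0, isHomogeneous_C _ _,
    isHomogeneous_one _ _, fun h => ?_, ?_⟩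
  · have := point_eval g a q T ha _ h
    simp at this
  · rw [map_one, one_mul]; exact (al_k g c).symm

lemma frac_mem {k : Type*} [Field k] (g : Fin 3 → MvPolynomial (Fin 2) k) (a : Fin 3 → k)
    (q : Fin 2 → k) (T : k) (ha : ∀ i, a i = T * eval q (g i)) (f s : coneRing g) (e : ℕ)
    (hf : (f : MvPolynomial (Fin 2) k).IsHomogeneous e)
    (hs : (s : MvPolynomial (Fin 2) k).IsHomogeneous e)
    (hsq : eval q (s : MvPolynomial (Fin 2) k) ≠ 0) :
    al g f / al g s ∈ curveLocalRing g a :=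
  Subring.subset_closure ⟨f, s, e, hf, hs, fun h => hsq (point_eval g a q T ha s h),
    mul_div_cancel₀ _ (cone_ne_zero hsq)⟩

lemma local_gen {k : Type*} [Field k] (d : ℕ) (hd : 0 < d) (g : Fin 3 → MvPolynomial (Fin 2) k)
    (hg : ∀ i, (g i).IsHomogeneous d) (a : Fin 3 → k)
    (q : Fin 2 → k) (T : k) (hT : T ≠ 0) (ha : ∀ i, a i = T * eval q (g i))
    (i0 i1 i2 : Fin 3) (hi0 : a i0 ≠ 0) (hi : ∀ i, i = i0 ∨ i = i1 ∨ i = i2)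
    (x : curveLocalRing g a) (hx : ¬ IsUnit x) :
    ∃ o1 ∈ curveLocalRing g a, ∃ o2 ∈ curveLocalRing g a,
      (x : FractionRing (coneRing g)) =
        o1 * (al g (coneGen g i1) / al g (coneGen g i0) - algebraMap k _ (a i1 / a i0)) +
        o2 * (al g (coneGen g i2) / al g (coneGen g i0) - algebraMap k _ (a i2 / a i0)) := by
  obtain ⟨f, s, e, hf, hs, hsq, h⟩ := (mem_local d hd g hg a q T hT ha i0 hi0 x).1 x.2
  have hfq : eval q (f : MvPolynomial (Fin 2) k) = 0 := by
    by_contra hfq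
    exact hx (local_unit d hd g hg a q T hT ha i0 hi0 x f s e hf hs hfq hsq h)
  have hs0 : al g s ≠ 0 := cone_ne_zero hsq
  have hb0 : eval q (g i0) ≠ 0 := by
    intro h0; apply hi0; rw [ha, h0, mul_zero]
  have hg0 : al g (coneGen g i0) ≠ 0 := cone_ne_zero (q := q) hb0
  by_cases hf0 : f = 0
  · refine ⟨0, Subring.zero_mem _, 0, Subring.zero_mem _, ?_⟩
    rw [hf0, map_zero] at h
    rcases mul_eq_zero.1 h with h | h
    · exact absurd h hs0
    · rw [h]; ring
  have hfne : (f : MvPolynomial (Fin 2) k) ≠ 0 := fun h => hf0 (Subtype.ext h)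
  have hsne : (s : MvPolynomial (Fin 2) k) ≠ 0 := fun h => hsq (by rw [h, map_zero])
  obtain ⟨m, Φ, hΦ, hem, hfΦ⟩ := cone_hom d hd g hg f f.2 e hf hfne
  set z : Fin 3 → FractionRing (coneRing g) := fun i => al g (coneGen g i) / al g (coneGen g i0)
    with hz
  have hzO : ∀ i, z i ∈ curveLocalRing g a := fun i =>
    frac_mem g a q T ha (coneGen g i) (coneGen g i0) d (hg i) (hg i0) hb0
  have hΦa : eval (fun i => a i / a i0) Φ = 0 := by
    have h3 := hom_scale Φ m hΦ (eval q (g i0))⁻¹ (fun i => eval q (g i))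
    have h6 : ∀ b : Fin 3 → k, MvPolynomial.aeval b Φ = eval b Φ := fun b => rfl
    rw [h6, h6, ← eval_comp, ← hfΦ, hfq, mul_zero] at h3
    rw [← h3]
    congr 2
    funext i
    rw [ha i, ha i0]
    field_simp
  have hfz : al g f = al g (coneGen g i0) ^ m * MvPolynomial.aeval z Φ := by
    rw [al_aeval g Φ f hfΦ, ← hom_scale Φ m hΦ]
    congr 2
    funext i
    rw [hz]
    exact (mul_div_cancel₀ _ hg0).symm
  obtain ⟨o1, ho1, o2, ho2, ho⟩ := taylor (curveLocalRing g a) (k_mem g a q T ha) z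
    (fun i => a i / a i0) hzO (z i1 - algebraMap k _ (a i1 / a i0))
    (z i2 - algebraMap k _ (a i2 / a i0)) (by
      intro i
      rcases hi i with rfl | rfl | rfl
      · refine ⟨0, Subring.zero_mem _, 0, Subring.zero_mem _, ?_⟩
        rw [hz]
        simp only [div_self hg0, div_self hi0, map_one]
        ring
      · exact ⟨1, Subring.one_mem _, 0, Subring.zero_mem _, by ring⟩
      · exact ⟨0, Subring.zero_mem _, 1, Subring.one_mem _, by ring⟩) Φ
  rw [hΦa, map_zero, sub_zero] at ho
  have hr : al g (coneGen g i0 ^ m) / al g s ∈ curveLocalRing g a :=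
    frac_mem g a q T ha _ s e (by rw [hem]; exact (hg i0).pow m) hs hsq
  refine ⟨_ * o1, Subring.mul_mem _ hr ho1, _ * o2, Subring.mul_mem _ hr ho2, ?_⟩
  have h' : al g s * (x : FractionRing (coneRing g)) = al g f := h
  have hxe : (x : FractionRing (coneRing g)) =
      al g (coneGen g i0 ^ m) / al g s * MvPolynomial.aeval z Φ := by
    rw [map_pow, div_mul_eq_mul_div, ← hfz, ← h']
    exact (mul_div_cancel_left₀ _ hs0).symm
  rw [hxe, ho]
  ring

lemma local_nonunit {k : Type*} [Field k] (d : ℕ) (hd : 0 < d) (g : Fin 3 → MvPolynomial (Fin 2) k)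
    (hg : ∀ i, (g i).IsHomogeneous d) (a : Fin 3 → k)
    (q : Fin 2 → k) (T : k) (hT : T ≠ 0) (ha : ∀ i, a i = T * eval q (g i))
    (i0 i : Fin 3) (hi0 : a i0 ≠ 0) (y : FractionRing (coneRing g)) (hy : y ∈ curveLocalRing g a) :
    (al g (coneGen g i) / al g (coneGen g i0) - algebraMap k _ (a i / a i0)) * y ≠ 1 := by
  intro h1
  obtain ⟨f, s, e, hf, hs, hsq, h⟩ := (mem_local d hd g hg a q T hT ha i0 hi0 y).1 hy
  have h' : al g s * y = al g f := h
  have hb0 : eval q (g i0) ≠ 0 := by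
    intro h0; apply hi0; rw [ha, h0, mul_zero]
  have hg0 : al g (coneGen g i0) ≠ 0 := cone_ne_zero (q := q) hb0
  have h2 : (al g (coneGen g i) - al g (coneGen g i0) * al g (algebraMap k _ (a i / a i0))) * al g f
      = al g (coneGen g i0) * al g s := by
    rw [al_k, ← h']
    have h3 : al g (coneGen g i0) * (al g (coneGen g i) / al g (coneGen g i0)) = al g (coneGen g i) :=
      mul_div_cancel₀ _ hg0
    linear_combination (al g (coneGen g i0) * al g s) * h1 - al g s * y * h3
  rw [← map_mul, ← map_sub, ← map_mul, ← map_mul] at h2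
  have h3 := congrArg Subtype.val
    ((IsFractionRing.injective (coneRing g) (FractionRing (coneRing g))) h2)
  have h4 : (g i - g i0 * C (a i / a i0)) * (f : MvPolynomial (Fin 2) k) =
    g i0 * (s : MvPolynomial (Fin 2) k) := h3
  have h5 := congrArg (eval q) h4
  rw [map_mul, map_mul, map_sub, map_mul, eval_C] at h5
  have h6 : eval q (g i) - eval q (g i0) * (a i / a i0) = 0 := by
    rw [ha i, ha i0]
    field_simp
    ring
  rw [h6, zero_mul] at h5
  exact mul_ne_zero hb0 hsq h5.symm

end Final2

section Final3

open MvPolynomial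

lemma P_exists {k K : Type*} [Field k] [Field K] [Algebra k K] (O : Subring K)
    (hkO : ∀ c : k, algebraMap k K c ∈ O) (t : K) (F H : Polynomial k) (d : ℕ)
    (hF : F.natDegree ≤ d) (hFd : F.coeff d ≠ 0) (hH : H.natDegree ≤ d) (hHd : H.coeff d = 0)
    (o : K) (ho : o ∈ O) (h : Polynomial.aeval t F = o * Polynomial.aeval t H) :
    ∃ P : Polynomial O, P.Monic ∧ Polynomial.eval₂ O.subtype t P = 0 := by
  let ι : k →+* O := (algebraMap k K).codRestrict O hkO
  have hι : O.subtype.comp ι = algebraMap k K := rfl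
  refine ⟨Polynomial.C (ι (F.coeff d)⁻¹) * (F.map ι - Polynomial.C ⟨o, ho⟩ * H.map ι), ?_, ?_⟩
  · refine Polynomial.monic_of_natDegree_le_of_coeff_eq_one d ?_ ?_
    · refine (Polynomial.natDegree_C_mul_le _ _).trans
        ((Polynomial.natDegree_sub_le _ _).trans (max_le ?_ ?_))
      · exact Polynomial.natDegree_map_le.trans hF
      · exact (Polynomial.natDegree_C_mul_le _ _).trans (Polynomial.natDegree_map_le.trans hH)
    · rw [Polynomial.coeff_C_mul, Polynomial.coeff_sub, Polynomial.coeff_C_mul,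
        Polynomial.coeff_map, Polynomial.coeff_map, hHd, map_zero, mul_zero, sub_zero, ← map_mul,
        inv_mul_cancel₀ hFd, map_one]
  · have e : ∀ G : Polynomial k, Polynomial.eval₂ O.subtype t (G.map ι) = Polynomial.aeval t G := by
      intro G
      rw [Polynomial.eval₂_map, hι]; rfl
    rw [Polynomial.eval₂_mul, Polynomial.eval₂_sub, Polynomial.eval₂_mul, e, e, h,
      Polynomial.eval₂_C, Polynomial.eval₂_C]
    change _ * (o * _ - o * _) = _
    ring

end Final3


/-- With the data of a birationally parameterized plane curve `C` of degree `d` with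
Hilbert–Burch matrix `φ` of column degrees `d₁ ≤ d₂` over an algebraically closed field:
every infinitely near singularity of `C` (a singular point, i.e. a point of multiplicity
`c ≥ 2`, appearing on some iterated blow-up of `C` at points over a point `p` of `C`) has
multiplicity at most `d₁`. -/
theorem stmt12 {k : Type*} [Field k] [IsAlgClosed k] (d d₁ d₂ : ℕ) (hd : 0 < d)
    (g : Fin 3 → MvPolynomial (Fin 2) k) (hg : ∀ i, (g i).IsHomogeneous d)
    (hmin : LinearIndependent k g)
    (hht : idealHeight (Ideal.span (Set.range g)) = 2)
    (hbir : ∀ v ∈ Algebra.adjoin k {f : MvPolynomial (Fin 2) k | f.IsHomogeneous d},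
      ∃ x ∈ Algebra.adjoin k (Set.range g), ∃ y ∈ Algebra.adjoin k (Set.range g),
        y ≠ 0 ∧ y * v = x)
    (φ : Matrix (Fin 3) (Fin 2) (MvPolynomial (Fin 2) k))
    (hHBinj : Function.Injective φ.mulVecLin)
    (hHBexact : LinearMap.range φ.mulVecLin =
      LinearMap.ker (Matrix.mulVecLin (Matrix.of fun (_ : Fin 1) (i : Fin 3) => g i)))
    (hcol1 : ∀ i, (φ i 0).IsHomogeneous d₁) (hcol2 : ∀ i, (φ i 1).IsHomogeneous d₂)
    (h12 : d₁ ≤ d₂) (hsum : d₁ + d₂ = d)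
    (a : Fin 3 → k) (ha : a ≠ 0) (haC : onCurve g a)
    (O' : Subring (FractionRing (coneRing g)))
    (hnear : IsInfinitelyNearTo (curveLocalRing g a) O')
    (c : ℕ) (hc : IsHSMultOfDimOne O' (nuIdeal O') c) (hsing : 2 ≤ c) :
    c ≤ d₁ := by
  obtain ⟨q, hq, T, hT, haq⟩ := haC
  obtain ⟨i0, hi0⟩ : ∃ i0, a i0 ≠ 0 := by
    by_contra h
    push Not at h
    exact ha (funext h)
  obtain ⟨i1, i2, h10, h20, h12', hi⟩ := pick_three i0
  have hb0 : eval q (g i0) ≠ 0 := by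
    intro h0; apply hi0; rw [haq, h0, mul_zero]
  have hlin : ∀ c0 c1 c2 : k, C c0 * g i0 + C c1 * g i1 + C c2 * g i2 = 0 →
      c0 = 0 ∧ c1 = 0 ∧ c2 = 0 := by
    intro c0 c1 c2 h
    have h' := Fintype.linearIndependent_iff.1 hmin
      (fun i => if i = i0 then c0 else if i = i1 then c1 else c2) (by
        rw [sum_three i0 i1 i2 h10 h20 h12']
        simp only [if_true, if_neg h10, if_neg h20, if_neg h12'.symm]
        simpa only [smul_eq_C_mul] using h)
    have e0 := h' i0
    have e1 := h' i1
    have e2 := h' i2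
    simp only [if_true, if_neg h10] at e0 e1
    simp only [if_neg h20, if_neg h12'.symm] at e2
    exact ⟨e0, e1, e2⟩
  -- the auxiliary direction
  obtain ⟨u, hu⟩ : ∃ u : Fin 2 → k, eval u (a i0 • g i1 - a i1 • g i0) ≠ 0 := by
    by_contra h
    push Not at h
    have h0 : a i0 • g i1 - a i1 • g i0 = 0 := MvPolynomial.funext (fun u => by
      rw [h u, map_zero])
    have := (hlin (-(a i1)) (a i0) 0 (by
      rw [smul_eq_C_mul, smul_eq_C_mul] at h0
      rw [C_neg, C_0]
      linear_combination h0)).2.1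
    exact hi0 this
  have hu0 : u ≠ 0 := by
    rintro rfl
    apply hu
    have hz : ∀ i, eval (0 : Fin 2 → k) (g i) = 0 := by
      intro i
      have h3 := hom_scale (g i) d (hg i) (0 : k) (0 : Fin 2 → k)
      rw [zero_pow hd.ne', zero_mul] at h3
      have h4 : (fun i : Fin 2 => (0 : k) * (0 : Fin 2 → k) i) = 0 := by
        funext i; simp
      rw [h4] at h3
      exact h3
    rw [map_sub, smul_eval, smul_eval, hz, hz]
    ring
  obtain ⟨v, huv⟩ := pick_v u hu0
  obtain ⟨t, ⟨m, x', y', hy'0, hx'h, hy'h, hyt⟩, hfrac, hnz⟩ := exists_t d hd g hg hbir u v huv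
  haveI : IsLocalRing (curveLocalRing g a) := local_isLocal d hd g hg a q T hT haq i0 hi0
  have hgn : ∀ i, coneGen g i ≠ 0 := by
    intro i h
    exact hmin.ne_zero i (congrArg Subtype.val h)
  have hal0 : al g (coneGen g i0) ≠ 0 := al_ne g _ (hgn i0)
  -- the monic equation
  have hP : ∃ P : Polynomial (curveLocalRing g a), P.Monic ∧
      Polynomial.eval₂ (curveLocalRing g a).subtype t P = 0 := by
    let Λ : coneRing g := algebraMap k (coneRing g) (eval u (g i1)) * coneGen g i0 -
      algebraMap k (coneRing g) (eval u (g i0)) * coneGen g i1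
    have hΛ : (Λ : MvPolynomial (Fin 2) k) =
      C (eval u (g i1)) * g i0 - C (eval u (g i0)) * g i1 := rfl
    have hΛh : (Λ : MvPolynomial (Fin 2) k).IsHomogeneous d := by
      rw [hΛ]
      have hC : ∀ (c : k) (i : Fin 3), (C c * g i).IsHomogeneous d := by
        intro c i
        have := (isHomogeneous_C (Fin 2) c).mul (hg i)
        simpa using this
      exact (hC _ _).sub (hC _ _)
    have hΛu : eval u (Λ : MvPolynomial (Fin 2) k) = 0 := by
      rw [hΛ, map_sub, map_mul, map_mul, eval_C, eval_C]; ring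
    have hkey : a i0 * eval u (g i1) - a i1 * eval u (g i0) ≠ 0 := by
      rw [map_sub, smul_eval, smul_eval] at hu; exact hu
    have hΛq : eval q (Λ : MvPolynomial (Fin 2) k) ≠ 0 := by
      rw [hΛ, map_sub, map_mul, map_mul, eval_C, eval_C]
      intro h
      apply hkey
      rw [haq i0, haq i1]
      linear_combination T * h
    obtain ⟨l, hl⟩ : ∃ l, eval u (g l) ≠ 0 := by
      by_contra h
      push Not at h
      apply hkey
      rw [h, h]; ring
    have hΛ0 : al g Λ ≠ 0 := cone_ne_zero hΛq
    refine P_exists (curveLocalRing g a) (k_mem g a q T haq) t (deh u v (g l)) (deh u v Λ) d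
      (deh_coeff u v _ d (hg l)).1 ?_ (deh_coeff u v _ d hΛh).1 ?_ (al g (coneGen g l) / al g Λ)
      (frac_mem g a q T haq _ _ d (hg l) hΛh hΛq) ?_
    · rw [(deh_coeff u v _ d (hg l)).2]; exact hl
    · rw [(deh_coeff u v _ d hΛh).2]; exact hΛu
    · have h := hfrac (coneGen g l) Λ d (hg l) hΛh
      have h' : al g (coneGen g l) * Polynomial.aeval t (deh u v Λ) =
        al g Λ * Polynomial.aeval t (deh u v (g l)) := h
      rw [div_mul_eq_mul_div, h']
      exact (mul_div_cancel_left₀ _ hΛ0).symm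
  obtain ⟨P, hPm, hPt⟩ := hP
  -- the first syzygy
  have hsyz : g i0 * φ i0 0 + g i1 * φ i1 0 + g i2 * φ i2 0 = 0 := by
    have h1 : φ.mulVecLin (Pi.single 0 1) ∈
        LinearMap.ker (Matrix.mulVecLin (Matrix.of fun (_ : Fin 1) (i : Fin 3) => g i)) := by
      rw [← hHBexact]; exact LinearMap.mem_range_self _ _
    have h2 := congrFun (LinearMap.mem_ker.1 h1) 0
    simp only [Matrix.mulVecLin_apply, Matrix.mulVec_single_one] at h2
    have h3 : ∑ i, g i * φ i 0 = 0 := h2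
    rw [sum_three i0 i1 i2 h10 h20 h12'] at h3
    exact h3
  have hcol : ¬(φ i0 0 = 0 ∧ φ i1 0 = 0 ∧ φ i2 0 = 0) := by
    rintro ⟨e0, e1, e2⟩
    have h1 : φ.mulVecLin (Pi.single 0 1) = φ.mulVecLin 0 := by
      rw [map_zero, Matrix.mulVecLin_apply, Matrix.mulVec_single_one]
      funext i
      change φ i 0 = 0
      rcases hi i with rfl | rfl | rfl
      · exact e0
      · exact e1
      · exact e2
    have h2 := congrFun (hHBinj h1) 0
    simp at h2
  have hgk : ∀ i, al g (coneGen g i) / al g (coneGen g i0) * Polynomial.aeval t (deh u v (g i0)) =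
      Polynomial.aeval t (deh u v (g i)) := by
    intro i
    have h : al g (coneGen g i) * Polynomial.aeval t (deh u v (g i0)) =
      al g (coneGen g i0) * Polynomial.aeval t (deh u v (g i)) :=
      hfrac (coneGen g i) (coneGen g i0) d (hg i) (hg i0)
    rw [div_mul_eq_mul_div, h]
    exact mul_div_cancel_left₀ _ hal0
  have hpow : ((coneGen g i0 ^ m : coneRing g) : MvPolynomial (Fin 2) k).IsHomogeneous (d * m) :=
    (hg i0).pow m
  have hpowq : eval q ((coneGen g i0 ^ m : coneRing g) : MvPolynomial (Fin 2) k) ≠ 0 := by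
    have : ((coneGen g i0 ^ m : coneRing g) : MvPolynomial (Fin 2) k) = g i0 ^ m := rfl
    rw [this, map_pow]
    exact pow_ne_zero _ hb0
  have hpow0 : al g (coneGen g i0 ^ m) ≠ 0 := cone_ne_zero hpowq
  have hyt' : al g y' * t = al g x' := hyt
  refine geom_main t (curveLocalRing g a) O' (k_mem g a q T haq) ?_
    (deh u v (g i0)) (deh u v (g i1)) (deh u v (g i2))
    (deh u v (φ i0 0)) (deh u v (φ i1 0)) (deh u v (φ i2 0)) (a i1 / a i0) (a i2 / a i0)
    (al g (coneGen g i1) / al g (coneGen g i0)) (al g (coneGen g i2) / al g (coneGen g i0))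
    (hnz (coneGen g i0) d (hg i0) (hgn i0)) (hgk i1) (hgk i2)
    (frac_mem g a q T haq _ _ d (hg i1) (hg i0) hb0)
    (frac_mem g a q T haq _ _ d (hg i2) (hg i0) hb0)
    (local_nonunit d hd g hg a q T hT haq i0 i1 hi0)
    (local_nonunit d hd g hg a q T hT haq i0 i2 hi0)
    (local_gen d hd g hg a q T hT haq i0 i1 i2 hi0 hi) ?_ ?_ ?_ d₁
    (deh_coeff u v _ d₁ (hcol1 i0)).1 (deh_coeff u v _ d₁ (hcol1 i1)).1
    (deh_coeff u v _ d₁ (hcol1 i2)).1 P hPm hPt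
    (al g y' / al g (coneGen g i0 ^ m)) (div_ne_zero (al_ne g _ hy'0) hpow0)
    (frac_mem g a q T haq _ _ (d * m) hy'h hpow hpowq) ?_ hnear c hc
  · intro x hx
    obtain ⟨f, s, e, hf, hs, hsq, h⟩ := (mem_local d hd g hg a q T hT haq i0 hi0 x).1 hx
    have hs0 : s ≠ 0 := by
      rintro rfl
      simp at hsq
    have h1 : al g s * x = al g f := h
    have h2 : al g f * Polynomial.aeval t (deh u v s) = al g s * Polynomial.aeval t (deh u v f) :=
      hfrac f s e hf hs
    have hal : al g s ≠ 0 := al_ne g s hs0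
    refine (IntermediateField.mem_adjoin_simple_iff k x).2 ⟨deh u v f, deh u v s, ?_⟩
    rw [eq_div_iff (hnz s e hs hs0)]
    apply mul_left_cancel₀ hal
    rw [← h2, ← h1]
    ring
  · intro c0 c1 c2 h
    apply hlin
    refine deh_inj u v huv _ d ?_ ?_
    · have hC : ∀ (c : k) (i : Fin 3), (C c * g i).IsHomogeneous d := by
        intro c i
        have := (isHomogeneous_C (Fin 2) c).mul (hg i)
        simpa using this
      exact ((hC _ _).add (hC _ _)).add (hC _ _)
    · have hCd : ∀ c : k, deh u v (C c) = Polynomial.C c := fun c => (deh u v).commutes c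
      rw [map_add, map_add, map_mul, map_mul, map_mul, hCd, hCd, hCd]
      exact h
  · rw [← map_mul, ← map_mul, ← map_mul, ← map_add, ← map_add, hsyz, map_zero]
  · rintro ⟨e0, e1, e2⟩
    exact hcol ⟨deh_inj u v huv _ d₁ (hcol1 i0) e0, deh_inj u v huv _ d₁ (hcol1 i1) e1,
      deh_inj u v huv _ d₁ (hcol1 i2) e2⟩
  · rw [div_mul_eq_mul_div, hyt']
    exact frac_mem g a q T haq _ _ (d * m) hx'h hpow hpowq
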